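/- arXiv:1210.0882 — 5 statements merged into one kernel-verified Lean document; each statement's English description precedes it below -/
import Mathlib

section
/- The Riemann hypothesis is equivalent to the following statement: for every D ∈ (0,1) with D ≠ 1/2 and every ordinary fractal string Ω of dimension D, if there exist constants c_D > 0 and δ > 0 such that N_ν(x) = W(x) − c_D x^D + O(x^{D−δ}) as x → +∞, then Ω is Minkowski measurable of dimension D. (Here the Riemann hypothesis asserts that every zero s of ζ with 0 < Re(s) < 1 satisfies Re(s) = 1/2.) -/
open MeasureTheory Filter Topology Asymptotics

/-- An ordinary fractal string: a bounded open subset `Ω ⊆ ℝ` realized as a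
countable disjoint union of (infinitely many) nonempty open intervals, whose
lengths `l_j = b_j - a_j` are listed in nonincreasing order. -/
structure FractalString where
  a : ℕ → ℝ
  b : ℕ → ℝ
  lt : ∀ j, a j < b j
  disj : Pairwise fun i j => Disjoint (Set.Ioo (a i) (b i)) (Set.Ioo (a j) (b j))
  bdd : Bornology.IsBounded (⋃ j, Set.Ioo (a j) (b j))
  anti : Antitone fun j => b j - a j

namespace FractalString

/-- The lengths `l_j` of the string. -/
def l (S : FractalString) (j : ℕ) : ℝ := S.b j - S.a j

/-- The bounded open set `Ω ⊆ ℝ` of the string. -/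
def Omega (S : FractalString) : Set ℝ := ⋃ j, Set.Ioo (S.a j) (S.b j)

/-- The inner `ε`-neighborhood `Ω_ε = {x ∈ Ω : dist(x, ∂Ω) < ε}` of `∂Ω`. -/
def innerNbhd (S : FractalString) (ε : ℝ) : Set ℝ :=
  {x ∈ S.Omega | Metric.infDist x (frontier S.Omega) < ε}

/-- The dimension of the string: the abscissa of convergence
`D = inf{σ : Σ_j l_j^σ < ∞}` of its geometric zeta function. -/
noncomputable def dimension (S : FractalString) : ℝ :=
  sInf {σ : ℝ | Summable fun j => S.l j ^ σ}

/-- The spectral counting function `N_ν(x) = Σ_j ⌊l_j x⌋`. -/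
noncomputable def Nnu (S : FractalString) (x : ℝ) : ℝ :=
  ∑' j : ℕ, (⌊S.l j * x⌋ : ℝ)

/-- The Weyl term `W(x) = vol₁(Ω)·x = (Σ_j l_j)·x`. -/
noncomputable def weyl (S : FractalString) (x : ℝ) : ℝ :=
  (∑' j : ℕ, S.l j) * x

/-- `vol₁(Ω_ε)/ε^{1-D} → M` as `ε → 0⁺`. -/
def MinkTendsto (S : FractalString) (D M : ℝ) : Prop :=
  Tendsto (fun ε : ℝ => (volume (S.innerNbhd ε)).toReal / ε ^ (1 - D))
    (𝓝[>] 0) (𝓝 M)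

/-- The string is Minkowski measurable of dimension `D`: the limit
`M = lim_{ε→0⁺} vol₁(Ω_ε)/ε^{1-D}` exists in `(0, ∞)`. -/
def MinkowskiMeasurable (S : FractalString) (D : ℝ) : Prop :=
  ∃ M, 0 < M ∧ S.MinkTendsto D M

/-- The geometric counting function `N_L(x) = #{j : l_j ≥ 1/x}`. -/
noncomputable def NL (S : FractalString) (x : ℝ) : ℕ :=
  {j : ℕ | 1 / x ≤ S.l j}.ncard

end FractalString

namespace FractalString

/-! ### The fractional part and the Riemann zeta function -/

lemma norm_fract_mul_cpow_le (s : ℂ) {x : ℝ} (hx : 0 < x) :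
    ‖((Int.fract x : ℝ) : ℂ) * (x : ℂ) ^ (-(s + 1))‖ ≤ x ^ (-(s.re + 1)) := by
  rw [norm_mul, Complex.norm_cpow_eq_rpow_re_of_pos hx, Complex.norm_real,
    Real.norm_of_nonneg (Int.fract_nonneg x)]
  have h : (-(s + 1)).re = -(s.re + 1) := by simp
  rw [h]
  exact mul_le_of_le_one_left (Real.rpow_nonneg hx.le _) (Int.fract_lt_one x).le

lemma aestronglyMeasurable_fract_mul_cpow (s : ℂ) {c : ℝ} (hc : 0 ≤ c) :
    AEStronglyMeasurable (fun x : ℝ => ((Int.fract x : ℝ) : ℂ) * (x : ℂ) ^ (-(s + 1)))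
      (volume.restrict (Set.Ioi c)) := by
  refine AEStronglyMeasurable.mul ?_ ?_
  · exact (Complex.measurable_ofReal.comp measurable_fract).aestronglyMeasurable
  · refine ContinuousOn.aestronglyMeasurable (fun t ht ↦ ?_) measurableSet_Ioi
    exact (Complex.continuousAt_ofReal_cpow_const _ _
      (Or.inr (hc.trans_lt ht).ne')).continuousWithinAt

lemma integrableOn_Ioi_fract_mul_cpow {s : ℂ} (hs : 0 < s.re) {c : ℝ} (hc : 0 < c) :
    IntegrableOn (fun x : ℝ => ((Int.fract x : ℝ) : ℂ) * (x : ℂ) ^ (-(s + 1))) (Set.Ioi c) := by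
  refine Integrable.mono' (integrableOn_Ioi_rpow_of_lt (a := -(s.re + 1)) (by linarith) hc)
    (aestronglyMeasurable_fract_mul_cpow s hc.le) ?_
  exact (ae_restrict_mem measurableSet_Ioi).mono
    fun x hx => norm_fract_mul_cpow_le s (hc.trans hx)

lemma norm_integral_Ioi_fract_mul_cpow_le {s : ℂ} (hs : 0 < s.re) {c : ℝ} (hc : 0 < c) :
    ‖∫ x in Set.Ioi c, ((Int.fract x : ℝ) : ℂ) * (x : ℂ) ^ (-(s + 1))‖ ≤ c ^ (-s.re) / s.re := by
  refine (norm_integral_le_of_norm_le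
    (integrableOn_Ioi_rpow_of_lt (a := -(s.re + 1)) (by linarith) hc)
    ((ae_restrict_mem measurableSet_Ioi).mono
      fun x hx => norm_fract_mul_cpow_le s (hc.trans hx))).trans ?_
  rw [integral_Ioi_rpow_of_lt (by linarith) hc]
  apply le_of_eq
  have : -(s.re + 1) + 1 = -s.re := by ring
  rw [this]
  field_simp

lemma fract_mul_cpow_eq (s : ℂ) {x : ℝ} (hx : x ∈ Set.Ioo (0 : ℝ) 1) :
    ((Int.fract x : ℝ) : ℂ) * (x : ℂ) ^ (-(s + 1)) = (x : ℂ) ^ (-s) := by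
  have hx0 : (x : ℂ) ≠ 0 := by exact_mod_cast hx.1.ne'
  rw [Int.fract_eq_self.2 ⟨hx.1.le, hx.2⟩]
  nth_rewrite 1 [← Complex.cpow_one (x : ℂ)]
  rw [← Complex.cpow_add _ _ hx0]
  congr 1; ring

lemma intervalIntegrable_fract_mul_cpow {s : ℂ} (hs1 : s.re < 1) :
    IntegrableOn (fun x : ℝ => ((Int.fract x : ℝ) : ℂ) * (x : ℂ) ^ (-(s + 1))) (Set.Ioc 0 1) := by
  rw [integrableOn_Ioc_iff_integrableOn_Ioo]
  refine IntegrableOn.congr_fun (f := fun x : ℝ => (x : ℂ) ^ (-s)) ?_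
    (fun x hx => (fract_mul_cpow_eq s hx).symm) measurableSet_Ioo
  rw [← integrableOn_Ioc_iff_integrableOn_Ioo,
    ← intervalIntegrable_iff_integrableOn_Ioc_of_le zero_le_one]
  exact intervalIntegral.intervalIntegrable_cpow' (by simpa using hs1)

lemma integral_Ioc_fract_mul_cpow {s : ℂ} (hs1 : s.re < 1) :
    ∫ x in Set.Ioc (0 : ℝ) 1, ((Int.fract x : ℝ) : ℂ) * (x : ℂ) ^ (-(s + 1)) = 1 / (1 - s) := by
  have hs : (1 - s) ≠ 0 := fun h => by
    have := congrArg Complex.re h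
    simp at this; linarith
  rw [integral_Ioc_eq_integral_Ioo,
    setIntegral_congr_fun measurableSet_Ioo (fun x hx => fract_mul_cpow_eq s hx),
    ← integral_Ioc_eq_integral_Ioo, ← intervalIntegral.integral_of_le zero_le_one,
    integral_cpow (Or.inl (by simpa using hs1))]
  have h1 : -s + 1 = 1 - s := by ring
  rw [h1]
  simp [Complex.zero_cpow hs]

lemma integrableOn_fract_mul_cpow {s : ℂ} (hs : 0 < s.re) (hs1 : s.re < 1) :
    IntegrableOn (fun x : ℝ => ((Int.fract x : ℝ) : ℂ) * (x : ℂ) ^ (-(s + 1))) (Set.Ioi 0) := by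
  rw [← Set.Ioc_union_Ioi_eq_Ioi (zero_le_one (α := ℝ))]
  exact (intervalIntegrable_fract_mul_cpow hs1).union (integrableOn_Ioi_fract_mul_cpow hs one_pos)

lemma differentiableOn_integral_fract_mul_cpow :
    DifferentiableOn ℂ
      (fun s : ℂ => ∫ x in Set.Ioi (1 : ℝ), ((Int.fract x : ℝ) : ℂ) * (x : ℂ) ^ (-(s + 1)))
      {s | 0 < s.re} := by
  intro s hs
  have hs : 0 < s.re := hs
  let f : ℝ → ℂ := (Set.Ioi (1 : ℝ)).indicator fun x => ((Int.fract x : ℝ) : ℂ)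
  have hf : Measurable f :=
    (Complex.measurable_ofReal.comp measurable_fract).indicator measurableSet_Ioi
  have hbd : ∀ x, ‖f x‖ ≤ 1 := fun x => by
    refine (norm_indicator_le_norm_self _ _).trans ?_
    rw [Complex.norm_real, Real.norm_of_nonneg (Int.fract_nonneg x)]
    exact (Int.fract_lt_one x).le
  have hmel : (fun s : ℂ => ∫ x in Set.Ioi (1 : ℝ),
      ((Int.fract x : ℝ) : ℂ) * (x : ℂ) ^ (-(s + 1))) = fun s => mellin f (-s) := by
    ext s
    have : ∀ x : ℝ, (x : ℂ) ^ (-s - 1) • f x = (Set.Ioi (1 : ℝ)).indicator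
        (fun x : ℝ => ((Int.fract x : ℝ) : ℂ) * (x : ℂ) ^ (-(s + 1))) x := by
      intro x
      by_cases hx : x ∈ Set.Ioi (1 : ℝ)
      · rw [Set.indicator_of_mem hx, smul_eq_mul, mul_comm]
        simp only [f, Set.indicator_of_mem hx]
        congr 2; ring
      · simp [f, Set.indicator_of_notMem hx]
    simp only [mellin, this]
    rw [setIntegral_indicator measurableSet_Ioi]
    congr 2
    exact (Set.inter_eq_right.2 <| Set.Ioi_subset_Ioi zero_le_one).symm
  rw [hmel]
  have h1 : DifferentiableAt ℂ (mellin f) (-s) := by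
    refine mellin_differentiableAt_of_isBigO_rpow (a := 0) (b := -s.re - 1) ?_ ?_ (by simpa using hs)
      ?_ (by simp)
    · refine (locallyIntegrable_const (1 : ℝ)).locallyIntegrableOn _ |>.mono
        hf.aestronglyMeasurable ?_
      exact Eventually.of_forall fun x => by simpa using hbd x
    · refine IsBigO.of_bound 1 (Eventually.of_forall fun x => ?_)
      simpa using hbd x
    · refine IsBigO.of_bound 1 ?_
      filter_upwards [Ioo_mem_nhdsGT (zero_lt_one (α := ℝ))] with x hx
      have : x ∉ Set.Ioi (1 : ℝ) := by simpa using hx.2.le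
      simp only [f, Set.indicator_of_notMem this, norm_zero]
      positivity
  exact (h1.comp s differentiableAt_id.neg).differentiableWithinAt

lemma riemannZeta_eq_of_one_lt_re {s : ℂ} (hs : 1 < s.re) :
    riemannZeta s = s / (s - 1) -
      s * ∫ x in Set.Ioi (1 : ℝ), ((Int.fract x : ℝ) : ℂ) * (x : ℂ) ^ (-(s + 1)) := by
  have hs1 : s - 1 ≠ 0 := fun h => by
    have := congrArg Complex.re h
    simp at this; linarith
  have h1 := LSeries_eq_mul_integral' (1 : ℕ → ℂ) zero_le_one hs (by
    refine IsBigO.of_bound 1 (Eventually.of_forall fun n => ?_)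
    simp)
  rw [LSeries_one_eq_riemannZeta hs] at h1
  rw [h1]
  have h2 : ∀ t ∈ Set.Ioi (1 : ℝ), (∑ k ∈ Finset.Icc 1 ⌊t⌋₊, (1 : ℕ → ℂ) k) * (t : ℂ) ^ (-(s + 1))
      = (t : ℂ) ^ (-s) - ((Int.fract t : ℝ) : ℂ) * (t : ℂ) ^ (-(s + 1)) := by
    intro t ht
    have ht0 : (0 : ℝ) < t := zero_lt_one.trans ht
    have ht0' : (t : ℂ) ≠ 0 := by exact_mod_cast ht0.ne'
    have e : (t : ℂ) ^ (-s) = t * (t : ℂ) ^ (-(s + 1)) := by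
      nth_rewrite 2 [← Complex.cpow_one (t : ℂ)]
      rw [← Complex.cpow_add _ _ ht0']
      congr 1; ring
    have e2 : ((⌊t⌋₊ : ℝ) : ℂ) = ((t - Int.fract t : ℝ) : ℂ) := by
      rw [natCast_floor_eq_intCast_floor ht0.le, Int.self_sub_fract]
    rw [e, ← sub_mul, ← Complex.ofReal_sub, ← e2]
    simp
  rw [setIntegral_congr_fun measurableSet_Ioi h2, integral_sub
    (integrableOn_Ioi_cpow_of_lt (by simpa using hs) one_pos)
    (integrableOn_Ioi_fract_mul_cpow (by linarith) one_pos), mul_sub,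
    integral_Ioi_cpow_of_lt (by simpa using hs) one_pos]
  congr 1
  have h3 : -s + 1 = -(s - 1) := by ring
  have h4 : 1 - s ≠ 0 := fun h => hs1 (by linear_combination -h)
  rw [h3, Complex.ofReal_one, Complex.one_cpow]
  field_simp

lemma riemannZeta_eq_of_re_pos {s : ℂ} (hs : 0 < s.re) (hs1 : s ≠ 1) :
    riemannZeta s = s / (s - 1) -
      s * ∫ x in Set.Ioi (1 : ℝ), ((Int.fract x : ℝ) : ℂ) * (x : ℂ) ^ (-(s + 1)) := by
  have hU : IsOpen {s : ℂ | 0 < s.re} := isOpen_lt continuous_const Complex.continuous_re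
  have h := AnalyticOnNhd.eqOn_of_preconnected_of_eventuallyEq (𝕜 := ℂ) (U := {s : ℂ | 0 < s.re})
    (f := riemannZeta₁)
    (g := fun s => s - s * (s - 1) *
      ∫ x in Set.Ioi (1 : ℝ), ((Int.fract x : ℝ) : ℂ) * (x : ℂ) ^ (-(s + 1))) (z₀ := 2)
    (differentiable_riemannZeta₁.differentiableOn.analyticOnNhd hU)
    (DifferentiableOn.analyticOnNhd (by
      exact differentiableOn_id.sub (((differentiableOn_id).mul
        (differentiableOn_id.sub_const 1)).mul differentiableOn_integral_fract_mul_cpow)) hU)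
    (convex_halfSpace_re_gt 0).isPreconnected (by simp) (by
      have : {s : ℂ | 1 < s.re} ∈ 𝓝 (2 : ℂ) :=
        (isOpen_lt continuous_const Complex.continuous_re).mem_nhds (by simp)
      filter_upwards [this] with s hs
      have hs1 : s ≠ 1 := fun h => by simp [h] at hs
      have hs1' : s - 1 ≠ 0 := sub_ne_zero.2 hs1
      have h1 := riemannZeta_eq_of_one_lt_re hs
      rw [riemannZeta_eq_inv_sub_mul hs1] at h1
      field_simp at h1
      rw [h1]
      ring) hs
  have hs1' : s - 1 ≠ 0 := sub_ne_zero.2 hs1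
  rw [riemannZeta_eq_inv_sub_mul hs1, h]
  field_simp

/-- The Mellin transform of the fractional part in the critical strip. -/
lemma integral_fract_mul_cpow {s : ℂ} (hs : 0 < s.re) (hs1 : s.re < 1) :
    ∫ x in Set.Ioi (0 : ℝ), ((Int.fract x : ℝ) : ℂ) * (x : ℂ) ^ (-(s + 1)) =
      -riemannZeta s / s := by
  have h1 : s ≠ 1 := fun h => by simp [h] at hs1
  have h0 : s ≠ 0 := fun h => by simp [h] at hs
  have h1' : s - 1 ≠ 0 := sub_ne_zero.2 h1
  have h1'' : 1 - s ≠ 0 := sub_ne_zero.2 h1.symm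
  rw [← Set.Ioc_union_Ioi_eq_Ioi (zero_le_one (α := ℝ)),
    setIntegral_union (Set.Ioc_disjoint_Ioi le_rfl) measurableSet_Ioi
      (intervalIntegrable_fract_mul_cpow hs1) (integrableOn_Ioi_fract_mul_cpow hs one_pos),
    integral_Ioc_fract_mul_cpow hs1, riemannZeta_eq_of_re_pos hs h1]
  field_simp
  ring

/-- On `(0, 1)` the zeta function takes negative real values. -/
lemma exists_riemannZeta_eq_neg {D : ℝ} (hD : D ∈ Set.Ioo (0 : ℝ) 1) :
    ∃ r : ℝ, 0 < r ∧ riemannZeta D = -(r : ℂ) := by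
  have h := integral_fract_mul_cpow (s := (D : ℂ)) (by simpa using hD.1) (by simpa using hD.2)
  have hint := integrableOn_fract_mul_cpow (s := (D : ℂ)) (by simpa using hD.1)
    (by simpa using hD.2)
  have e : ∀ x ∈ Set.Ioi (0 : ℝ), ((Int.fract x : ℝ) : ℂ) * (x : ℂ) ^ (-((D : ℂ) + 1)) =
      ((Int.fract x * x ^ (-(D + 1)) : ℝ) : ℂ) := by
    intro x hx
    rw [Complex.ofReal_mul, Complex.ofReal_cpow (le_of_lt hx)]
    push_cast; rfl
  rw [setIntegral_congr_fun measurableSet_Ioi e, integral_complex_ofReal] at h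
  have hint' : IntegrableOn (fun x : ℝ => Int.fract x * x ^ (-(D + 1))) (Set.Ioi 0) := by
    have := (hint.congr_fun e measurableSet_Ioi).re
    simp only [RCLike.re_to_complex, Complex.ofReal_re] at this
    exact this
  have hpos : 0 < ∫ x in Set.Ioi (0 : ℝ), Int.fract x * x ^ (-(D + 1)) := by
    rw [setIntegral_pos_iff_support_of_nonneg_ae ?_ hint']
    · refine lt_of_lt_of_le ?_ (measure_mono (s := Set.Ioo (0 : ℝ) 1) ?_)
      · simp
      · intro x hx
        refine ⟨?_, hx.1⟩
        simp only [Function.mem_support]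
        rw [Int.fract_eq_self.2 ⟨hx.1.le, hx.2⟩]
        exact (mul_pos hx.1 (Real.rpow_pos_of_pos hx.1 _)).ne'
    · refine (ae_restrict_mem measurableSet_Ioi).mono fun x hx => ?_
      exact mul_nonneg (Int.fract_nonneg x) (Real.rpow_nonneg (le_of_lt hx) _)
  refine ⟨D * ∫ x in Set.Ioi (0 : ℝ), Int.fract x * x ^ (-(D + 1)), mul_pos hD.1 hpos, ?_⟩
  have hD0 : (D : ℂ) ≠ 0 := by exact_mod_cast hD.1.ne'
  push_cast
  rw [h]
  field_simp

/-- Partial sums of the Dirichlet series of zeta inside the critical strip. -/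
lemma norm_sum_cpow_sub_le {s : ℂ} (hs : 0 < s.re) (hs1 : s.re < 1) {K : ℕ} (hK : 1 ≤ K) :
    ‖∑ k ∈ Finset.Icc 1 K, (k : ℂ) ^ (-s) - (K : ℂ) ^ (1 - s) / (1 - s) - riemannZeta s‖ ≤
      ‖s‖ / s.re * (K : ℝ) ^ (-s.re) := by
  have h1 : s ≠ 1 := fun h => by simp [h] at hs1
  have h0 : s ≠ 0 := fun h => by simp [h] at hs
  have h1' : s - 1 ≠ 0 := sub_ne_zero.2 h1
  have h1'' : 1 - s ≠ 0 := sub_ne_zero.2 h1.symm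
  have hKpos : (0 : ℝ) < K := by exact_mod_cast hK
  have hK1 : (1 : ℝ) ≤ K := by exact_mod_cast hK
  have hK0 : (K : ℂ) ≠ 0 := by exact_mod_cast hKpos.ne'
  have hder : ∀ t ∈ Set.Icc (1 : ℝ) K,
      HasDerivAt (fun t : ℝ => (t : ℂ) ^ (-s)) (-s * (t : ℂ) ^ (-s - 1)) t := by
    intro t ht
    have ht0 : t ≠ 0 := (zero_lt_one.trans_le ht.1).ne'
    have := hasDerivAt_ofReal_cpow_const' (x := t) (r := -s - 1) ht0 (by
      intro h; apply h0; linear_combination -h)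
    have h3 := this.const_mul (-s)
    have h4 : (-s - 1 + 1) = -s := by ring
    rw [h4] at h3
    refine h3.congr_of_eventuallyEq (Eventually.of_forall fun y => ?_)
    field_simp
  have hcont : ContinuousOn (fun t : ℝ => -s * (t : ℂ) ^ (-s - 1)) (Set.Icc (1 : ℝ) K) := by
    intro t ht
    have ht0 : t ≠ 0 := (zero_lt_one.trans_le ht.1).ne'
    exact ((Complex.continuousAt_ofReal_cpow_const _ _ (Or.inr ht0)).const_mul _).continuousWithinAt
  have habel := sum_mul_eq_sub_integral_mul₀' (f := fun t : ℝ => (t : ℂ) ^ (-s))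
    (fun n : ℕ => if n = 0 then (0 : ℂ) else 1) (by simp) K
    (fun t ht => (hder t ht).differentiableAt)
    ((hcont.integrableOn_Icc).congr_fun (fun t ht => (hder t ht).deriv.symm) measurableSet_Icc)
  have hsum : ∀ n : ℕ, ∑ k ∈ Finset.Icc 0 n, (if k = 0 then (0 : ℂ) else 1) = n := by
    intro n
    rw [← Finset.Ico_succ_right_eq_Icc, ← Finset.range_eq_Ico, Nat.succ_eq_succ,
      Finset.sum_range_succ']
    simp
  have hleft : ∑ k ∈ Finset.Icc 0 K, ((k : ℝ) : ℂ) ^ (-s) * (if k = 0 then (0 : ℂ) else 1) =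
      ∑ k ∈ Finset.Icc 1 K, (k : ℂ) ^ (-s) := by
    rw [← Finset.insert_Icc_add_one_left_eq_Icc (Nat.zero_le K),
      Finset.sum_insert (by simp)]
    simp only [if_true, mul_zero, zero_add]
    refine Finset.sum_congr rfl fun k hk => ?_
    have : k ≠ 0 := by have := (Finset.mem_Icc.1 hk).1; omega
    simp [this]
  simp only [hsum, hleft] at habel
  have hint : ∀ t ∈ Set.Ioc (1 : ℝ) K, deriv (fun t : ℝ => (t : ℂ) ^ (-s)) t * (⌊t⌋₊ : ℂ) =
      -s * (t : ℂ) ^ (-s) + s * (((Int.fract t : ℝ) : ℂ) * (t : ℂ) ^ (-(s + 1))) := by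
    intro t ht
    have ht0 : (0 : ℝ) < t := zero_lt_one.trans ht.1
    have ht0' : (t : ℂ) ≠ 0 := by exact_mod_cast ht0.ne'
    have e : (t : ℂ) ^ (-s) = t * (t : ℂ) ^ (-s - 1) := by
      nth_rewrite 2 [← Complex.cpow_one (t : ℂ)]
      rw [← Complex.cpow_add _ _ ht0']
      congr 1; ring
    have e2 : ((⌊t⌋₊ : ℝ) : ℂ) = ((t - Int.fract t : ℝ) : ℂ) := by
      rw [natCast_floor_eq_intCast_floor ht0.le, Int.self_sub_fract]
    have e3 : (⌊t⌋₊ : ℂ) = t - ((Int.fract t : ℝ) : ℂ) := by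
      rw [← Complex.ofReal_sub, ← e2]; simp
    have e4 : -(s + 1) = -s - 1 := by ring
    rw [(hder t ⟨ht.1.le, ht.2⟩).deriv, e, e3, e4]
    ring
  have hI1 : IntegrableOn (fun t : ℝ => (t : ℂ) ^ (-s)) (Set.Ioc 1 (K : ℝ)) := by
    rw [← intervalIntegrable_iff_integrableOn_Ioc_of_le hK1]
    exact intervalIntegral.intervalIntegrable_cpow' (by simpa using hs1)
  have hI := integrableOn_Ioi_fract_mul_cpow hs one_pos
  have hIK := integrableOn_Ioi_fract_mul_cpow hs hKpos
  have hsplit : ∫ x in Set.Ioi (1 : ℝ), ((Int.fract x : ℝ) : ℂ) * (x : ℂ) ^ (-(s + 1)) =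
      (∫ x in Set.Ioc (1 : ℝ) K, ((Int.fract x : ℝ) : ℂ) * (x : ℂ) ^ (-(s + 1))) +
      ∫ x in Set.Ioi (K : ℝ), ((Int.fract x : ℝ) : ℂ) * (x : ℂ) ^ (-(s + 1)) := by
    rw [← Set.Ioc_union_Ioi_eq_Ioi hK1]
    exact setIntegral_union (Set.Ioc_disjoint_Ioi le_rfl) measurableSet_Ioi
      (hI.mono_set Set.Ioc_subset_Ioi_self) hIK
  rw [setIntegral_congr_fun measurableSet_Ioc hint,
    integral_add (hI1.const_mul _) ((hI.mono_set Set.Ioc_subset_Ioi_self).const_mul _),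
    integral_const_mul, integral_const_mul, ← intervalIntegral.integral_of_le hK1,
    integral_cpow (Or.inl (by simpa using hs1))] at habel
  have hKs : (K : ℂ) ^ (-s) * K = (K : ℂ) ^ (1 - s) := by
    nth_rewrite 2 [← Complex.cpow_one (K : ℂ)]
    rw [← Complex.cpow_add _ _ hK0]
    congr 1; ring
  have h2 : -s + 1 = 1 - s := by ring
  have key : ∑ k ∈ Finset.Icc 1 K, (k : ℂ) ^ (-s) - (K : ℂ) ^ (1 - s) / (1 - s) - riemannZeta s =
      s * ∫ x in Set.Ioi (K : ℝ), ((Int.fract x : ℝ) : ℂ) * (x : ℂ) ^ (-(s + 1)) := by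
    rw [riemannZeta_eq_of_re_pos hs h1, hsplit, habel, h2, Complex.ofReal_natCast, hKs,
      Complex.ofReal_one, Complex.one_cpow]
    field_simp
    ring
  rw [key, norm_mul]
  refine (mul_le_mul_of_nonneg_left (norm_integral_Ioi_fract_mul_cpow_le hs hKpos)
    (norm_nonneg s)).trans (le_of_eq ?_)
  ring
end FractalString

namespace FractalString

/-! ### Tube volumes of a fractal string -/

variable (S : FractalString)

lemma l_pos (j : ℕ) : 0 < S.l j := sub_pos.2 (S.lt j)

lemma isOpen_Omega : IsOpen S.Omega := isOpen_iUnion fun _ => isOpen_Ioo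

lemma volume_Omega_lt_top : volume S.Omega < ⊤ := S.bdd.measure_lt_top

lemma summable_l : Summable S.l := by
  have h := S.volume_Omega_lt_top
  rw [Omega, measure_iUnion S.disj fun _ => measurableSet_Ioo] at h
  simp only [Real.volume_Ioo] at h
  have := ENNReal.summable_toReal h.ne
  refine this.congr fun j => ?_
  exact ENNReal.toReal_ofReal (S.l_pos j).le

lemma left_notMem_Omega (j : ℕ) : S.a j ∉ S.Omega := by
  intro h
  obtain ⟨i, hi⟩ := Set.mem_iUnion.1 h
  have hij : i ≠ j := by rintro rfl; exact lt_irrefl _ hi.1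
  have h1 := S.lt j
  have hlt : S.a j < min (S.b i) (S.b j) := lt_min hi.2 h1
  obtain ⟨x, hx1, hx2⟩ := exists_between hlt
  exact Set.disjoint_left.1 (S.disj hij) (show x ∈ Set.Ioo (S.a i) (S.b i) from
    ⟨hi.1.trans hx1, hx2.trans_le (min_le_left _ _)⟩) ⟨hx1, hx2.trans_le (min_le_right _ _)⟩

lemma right_notMem_Omega (j : ℕ) : S.b j ∉ S.Omega := by
  intro h
  obtain ⟨i, hi⟩ := Set.mem_iUnion.1 h
  have hij : i ≠ j := by rintro rfl; exact lt_irrefl _ hi.2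
  have h1 := S.lt j
  have hlt : max (S.a i) (S.a j) < S.b j := max_lt hi.1 h1
  obtain ⟨x, hx1, hx2⟩ := exists_between hlt
  exact Set.disjoint_left.1 (S.disj hij) (show x ∈ Set.Ioo (S.a i) (S.b i) from
    ⟨(le_max_left _ _).trans_lt hx1, hx2.trans hi.2⟩) ⟨(le_max_right _ _).trans_lt hx1, hx2⟩

lemma frontier_Omega : frontier S.Omega = closure S.Omega \ S.Omega :=
  S.isOpen_Omega.frontier_eq

lemma Ioo_subset_Omega (j : ℕ) : Set.Ioo (S.a j) (S.b j) ⊆ S.Omega :=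
  Set.subset_iUnion (fun j => Set.Ioo (S.a j) (S.b j)) j

lemma Icc_subset_closure_Omega (j : ℕ) : Set.Icc (S.a j) (S.b j) ⊆ closure S.Omega := by
  rw [← closure_Ioo (S.lt j).ne]
  exact closure_mono (S.Ioo_subset_Omega j)

lemma left_mem_frontier (j : ℕ) : S.a j ∈ frontier S.Omega := by
  rw [frontier_Omega]
  exact ⟨S.Icc_subset_closure_Omega j (Set.left_mem_Icc.2 (S.lt j).le), S.left_notMem_Omega j⟩

lemma right_mem_frontier (j : ℕ) : S.b j ∈ frontier S.Omega := by
  rw [frontier_Omega]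
  exact ⟨S.Icc_subset_closure_Omega j (Set.right_mem_Icc.2 (S.lt j).le), S.right_notMem_Omega j⟩

lemma infDist_frontier_lt_iff {j : ℕ} {x ε : ℝ} (hx : x ∈ Set.Ioo (S.a j) (S.b j)) :
    Metric.infDist x (frontier S.Omega) < ε ↔ x ∉ Set.Icc (S.a j + ε) (S.b j - ε) := by
  rw [Metric.infDist_lt_iff ⟨_, S.left_mem_frontier j⟩, Set.mem_Icc, not_and_or, not_le, not_le]
  constructor
  · rintro ⟨y, hy, hxy⟩
    rw [frontier_Omega] at hy
    have hy' : y ∉ Set.Ioo (S.a j) (S.b j) := fun h => hy.2 (S.Ioo_subset_Omega j h)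
    rw [Real.dist_eq, abs_lt] at hxy
    rw [Set.mem_Ioo, not_and_or, not_lt, not_lt] at hy'
    rcases hy' with h | h
    · left; linarith [hxy.2]
    · right; linarith [hxy.1]
  · rintro (h | h)
    · refine ⟨_, S.left_mem_frontier j, ?_⟩
      rw [Real.dist_eq, abs_of_pos (sub_pos.2 hx.1)]; linarith
    · refine ⟨_, S.right_mem_frontier j, ?_⟩
      rw [Real.dist_eq, abs_of_neg (sub_neg.2 hx.2)]; linarith

lemma innerNbhd_eq_iUnion (ε : ℝ) : S.innerNbhd ε =
    ⋃ j, (Set.Ioo (S.a j) (S.b j) \ Set.Icc (S.a j + ε) (S.b j - ε)) := by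
  ext x
  simp only [innerNbhd, Omega, Set.mem_ofPred_eq, Set.mem_iUnion, Set.mem_sdiff]
  constructor
  · rintro ⟨⟨j, hj⟩, h⟩
    exact ⟨j, hj, (S.infDist_frontier_lt_iff hj).1 h⟩
  · rintro ⟨j, hj, h⟩
    exact ⟨⟨j, hj⟩, (S.infDist_frontier_lt_iff hj).2 h⟩

lemma volume_innerNbhd {ε : ℝ} (hε : 0 < ε) :
    (volume (S.innerNbhd ε)).toReal = ∑' j, min (S.l j) (2 * ε) := by
  have hd : Pairwise (Function.onFun Disjoint
      fun j => Set.Ioo (S.a j) (S.b j) \ Set.Icc (S.a j + ε) (S.b j - ε)) :=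
    fun i j hij => (S.disj hij).mono Set.sdiff_subset Set.sdiff_subset
  rw [innerNbhd_eq_iUnion, measure_iUnion hd fun j => measurableSet_Ioo.diff measurableSet_Icc]
  have hv : ∀ j, volume (Set.Ioo (S.a j) (S.b j) \ Set.Icc (S.a j + ε) (S.b j - ε)) =
      ENNReal.ofReal (min (S.l j) (2 * ε)) := by
    intro j
    have hsub : Set.Icc (S.a j + ε) (S.b j - ε) ⊆ Set.Ioo (S.a j) (S.b j) :=
      fun x hx => ⟨by linarith [hx.1], by linarith [hx.2]⟩
    rw [measure_sdiff hsub measurableSet_Icc.nullMeasurableSet measure_Icc_lt_top.ne, Real.volume_Ioo, Real.volume_Icc]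
    rcases le_total (S.l j) (2 * ε) with h | h
    · rw [min_eq_left h, ENNReal.ofReal_of_nonpos (p := S.b j - ε - (S.a j + ε))
        (by unfold l at h; linarith), tsub_zero, l]
    · rw [min_eq_right h, ← ENNReal.ofReal_sub _ (by unfold l at h; linarith)]
      congr 1; ring
  simp only [hv]
  rw [ENNReal.tsum_toReal_eq (fun j => ENNReal.ofReal_ne_top)]
  refine tsum_congr fun j => ENNReal.toReal_ofReal ?_
  exact le_min (S.l_pos j).le (by linarith)

/-- The difference between the Weyl term and the spectral counting function. -/
lemma weyl_sub_Nnu {x : ℝ} (hx : 0 < x) :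
    Summable (fun j => Int.fract (S.l j * x)) ∧
      S.weyl x - S.Nnu x = ∑' j, Int.fract (S.l j * x) := by
  have hs : Summable fun j => S.l j * x := S.summable_l.mul_right x
  have hf : Summable fun j => Int.fract (S.l j * x) := by
    refine Summable.of_nonneg_of_le (fun j => Int.fract_nonneg _) (fun j => ?_) hs
    have : 0 ≤ ⌊S.l j * x⌋ := Int.floor_nonneg.2 (mul_pos (S.l_pos j) hx).le
    have h2 : (0 : ℝ) ≤ ⌊S.l j * x⌋ := by exact_mod_cast this
    have := Int.self_sub_floor (S.l j * x)
    linarith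
  refine ⟨hf, ?_⟩
  have hfl : Summable fun j => (⌊S.l j * x⌋ : ℝ) := by
    refine (hs.sub hf).congr fun j => ?_
    exact Int.self_sub_fract _
  rw [weyl, Nnu, ← tsum_mul_right, ← hs.tsum_sub hfl]
  exact tsum_congr fun j => Int.self_sub_floor _

end FractalString

namespace FractalString

/-! ### Counting functions with a prescribed profile -/

lemma hasSum_indicator_of_profile {l : ℕ → ℝ} {g : ℝ → ℝ}
    (hlg : ∀ v > 0, ∀ j : ℕ, v ≤ l j ↔ (j : ℝ) + 1 ≤ g v) {v : ℝ} (hv : 0 < v) :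
    HasSum (fun j => if v ≤ l j then (1 : ℝ) else 0) ⌊g v⌋₊ := by
  have h : ∀ j : ℕ, v ≤ l j ↔ j ∈ Finset.range ⌊g v⌋₊ := by
    intro j
    rw [hlg v hv, Finset.mem_range, ← Nat.succ_le_iff, Nat.le_floor_iff' (Nat.succ_ne_zero j)]
    push_cast; rfl
  have h2 := hasSum_sum_of_ne_finset_zero (L := SummationFilter.unconditional ℕ) (f := fun j => if v ≤ l j then (1 : ℝ) else 0)
    (s := Finset.range ⌊g v⌋₊) (fun j hj => by rw [if_neg]; rwa [h])
  convert h2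
  rw [Finset.sum_congr rfl (fun j hj => if_pos ((h j).2 hj))]
  simp

/-- Truncated lengths add up to the integral of the profile, up to the rounding error. -/
lemma abs_tsum_min_sub_integral_le {l : ℕ → ℝ} (hpos : ∀ j, 0 < l j) (hl : Summable l) {g : ℝ → ℝ}
    (hlg : ∀ v > 0, ∀ j : ℕ, v ≤ l j ↔ (j : ℝ) + 1 ≤ g v) (hg0 : ∀ v > 0, 0 ≤ g v)
    {ε : ℝ} (hε : 0 < ε) (hg : IntegrableOn g (Set.Ioc 0 ε)) :
    |∑' j, min (l j) ε - ∫ v in Set.Ioc 0 ε, g v| ≤ ε := by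
  have hint : ∀ j, ∫ v in Set.Ioc 0 ε, (if v ≤ l j then (1 : ℝ) else 0) = min (l j) ε := by
    intro j
    have : (fun v => if v ≤ l j then (1 : ℝ) else 0) = (Set.Iic (l j)).indicator 1 := by
      ext v; simp [Set.indicator_apply]
    rw [this, setIntegral_indicator measurableSet_Iic, Set.Ioc_inter_Iic]
    simp only [Pi.one_apply, integral_const, smul_eq_mul, mul_one, measureReal_restrict_apply_univ]
    rw [Real.volume_real_Ioc_of_le (le_min hε.le (hpos j).le), sub_zero, min_comm]
  have hI : ∀ j, IntegrableOn (fun v => if v ≤ l j then (1 : ℝ) else 0) (Set.Ioc 0 ε) := by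
    intro j
    refine Measure.integrableOn_of_bounded (M := 1) measure_Ioc_lt_top.ne
      (Measurable.ite measurableSet_Iic measurable_const measurable_const).aestronglyMeasurable
      (Eventually.of_forall fun v => ?_)
    split_ifs <;> simp
  have hsum : Summable fun j => min (l j) ε :=
    Summable.of_nonneg_of_le (fun j => le_min (hpos j).le hε.le) (fun j => min_le_left _ _) hl
  have key := hasSum_integral_of_summable_integral_norm hI (by
    refine hsum.congr fun j => ?_
    rw [← hint j]
    refine integral_congr_ae (Eventually.of_forall fun v => ?_)
    dsimp only
    split_ifs <;> simp)
  have key2 : ∫ v in Set.Ioc 0 ε, (∑' j, if v ≤ l j then (1 : ℝ) else 0) =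
      ∫ v in Set.Ioc 0 ε, (⌊g v⌋₊ : ℝ) :=
    setIntegral_congr_fun measurableSet_Ioc
      fun v hv => (hasSum_indicator_of_profile hlg hv.1).tsum_eq
  simp only [hint] at key
  rw [key.tsum_eq, key2]
  have hfl : IntegrableOn (fun v => (⌊g v⌋₊ : ℝ)) (Set.Ioc 0 ε) := by
    refine Integrable.mono' hg ?_ ?_
    · exact (measurable_from_nat.comp_aemeasurable
        (Nat.measurable_floor.comp_aemeasurable hg.aemeasurable)).aestronglyMeasurable
    · refine (ae_restrict_mem measurableSet_Ioc).mono fun v hv => ?_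
      simpa using Nat.floor_le (hg0 v hv.1)
  rw [← integral_sub hfl hg, ← Real.norm_eq_abs]
  have := norm_setIntegral_le_of_norm_le_const (μ := volume) (s := Set.Ioc 0 ε) (C := 1)
    (f := fun v => (⌊g v⌋₊ : ℝ) - g v) measure_Ioc_lt_top (fun v hv => by
      rw [Real.norm_eq_abs, abs_le]
      constructor
      · linarith [Nat.lt_floor_add_one (g v)]
      · linarith [Nat.floor_le (hg0 v hv.1)])
  simpa [Real.volume_real_Ioc_of_le hε.le] using this

lemma abs_fract_sub_min_add_card_le (u : ℝ) (hu : 0 ≤ u) (K : ℕ) :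
    |Int.fract u - min u K + ∑ k ∈ Finset.Icc 1 K, (if (k : ℝ) ≤ u then (1 : ℝ) else 0)| ≤
      if (K : ℝ) ≤ u then 1 else 0 := by
  have hcard : ∑ k ∈ Finset.Icc 1 K, (if (k : ℝ) ≤ u then (1 : ℝ) else 0) =
      (min K ⌊u⌋₊ : ℕ) := by
    rw [← Finset.sum_filter, Finset.sum_const, nsmul_eq_mul, mul_one]
    have : (Finset.Icc 1 K).filter (fun k : ℕ => (k : ℝ) ≤ u) = Finset.Icc 1 (min K ⌊u⌋₊) := by
      ext k
      simp only [Finset.mem_filter, Finset.mem_Icc, le_min_iff, Nat.le_floor_iff hu]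
      tauto
    rw [this, Nat.card_Icc, Nat.add_sub_cancel]
  rw [hcard]
  split_ifs with h
  · rw [min_eq_right h, min_eq_left (Nat.le_floor h), sub_add_cancel,
      abs_of_nonneg (Int.fract_nonneg u)]
    exact (Int.fract_lt_one u).le
  · push Not at h
    have h1 : ⌊u⌋₊ ≤ K := by
      have := (Nat.floor_le hu).trans h.le
      exact_mod_cast this
    rw [min_eq_left h.le, min_eq_right h1, natCast_floor_eq_intCast_floor hu, Int.fract]
    simp

/-- Comparison of the spectral error term with the profile, by truncation at height `K`. -/
lemma abs_tsum_fract_sub_le {l : ℕ → ℝ} (hpos : ∀ j, 0 < l j) (hl : Summable l) {g : ℝ → ℝ}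
    (hlg : ∀ v > 0, ∀ j : ℕ, v ≤ l j ↔ (j : ℝ) + 1 ≤ g v) (hg0 : ∀ v > 0, 0 ≤ g v)
    {x : ℝ} (hx : 0 < x) {K : ℕ} (hK : 1 ≤ K) (hg : IntegrableOn g (Set.Ioc 0 (K / x))) :
    |∑' j, Int.fract (l j * x) - (x * (∫ v in Set.Ioc 0 (K / x), g v) -
      ∑ k ∈ Finset.Icc 1 K, g (k / x))| ≤ 2 * K + g (K / x) := by
  have hKpos : (0 : ℝ) < K := by exact_mod_cast hK
  have hKx : 0 < K / x := div_pos hKpos hx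
  have hmin : ∀ j, min (l j * x) K = x * min (l j) (K / x) := by
    intro j
    rw [mul_min_of_nonneg _ _ hx.le, mul_comm, mul_div_cancel₀ _ hx.ne']
  have hs1 : Summable fun j => min (l j) (K / x) :=
    Summable.of_nonneg_of_le (fun j => le_min (hpos j).le hKx.le) (fun j => min_le_left _ _) hl
  have hs2 : Summable fun j => min (l j * x) K := by
    simp only [hmin]; exact hs1.mul_left x
  have hs0 : Summable fun j => Int.fract (l j * x) := by
    refine Summable.of_nonneg_of_le (fun j => Int.fract_nonneg _) (fun j => ?_) (hl.mul_right x)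
    have : (0 : ℝ) ≤ ⌊l j * x⌋ := by exact_mod_cast Int.floor_nonneg.2 (mul_pos (hpos j) hx).le
    linarith [Int.self_sub_floor (l j * x)]
  have hind : ∀ k : ℕ, 1 ≤ k →
      HasSum (fun j => if (k : ℝ) ≤ l j * x then (1 : ℝ) else 0) ⌊g (k / x)⌋₊ := by
    intro k hk
    have hk0 : (0 : ℝ) < k := by exact_mod_cast hk
    have := hasSum_indicator_of_profile hlg (div_pos hk0 hx)
    simpa only [div_le_iff₀ hx] using this
  have hind2 := hasSum_sum (s := Finset.Icc 1 K) fun k hk => hind k (Finset.mem_Icc.1 hk).1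
  have hall := (hs0.hasSum.sub hs2.hasSum).add hind2
  have h1 : |∑' j, Int.fract (l j * x) - ∑' j, min (l j * x) K +
      ∑ k ∈ Finset.Icc 1 K, (⌊g (k / x)⌋₊ : ℝ)| ≤ ⌊g (K / x)⌋₊ := by
    have hnn : ∀ j, |_| ≤ _ := fun j =>
      abs_fract_sub_min_add_card_le (l j * x) (mul_pos (hpos j) hx).le K
    rw [abs_le]
    refine ⟨?_, hasSum_le (fun j => (abs_le.1 (hnn j)).2) hall (hind K hK)⟩
    exact hasSum_le (fun j => (abs_le.1 (hnn j)).1) (hind K hK).neg hall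
  have h2 := abs_tsum_min_sub_integral_le hpos hl hlg hg0 hKx hg
  have h3 : |∑ k ∈ Finset.Icc 1 K, g (k / x) - ∑ k ∈ Finset.Icc 1 K, (⌊g (k / x)⌋₊ : ℝ)| ≤ K := by
    rw [← Finset.sum_sub_distrib]
    refine (Finset.abs_sum_le_sum_abs _ _).trans ?_
    refine (Finset.sum_le_sum (g := fun _ => (1 : ℝ)) fun k hk => ?_).trans (by simp)
    have hk0 : (0 : ℝ) < k := by exact_mod_cast (Finset.mem_Icc.1 hk).1
    rw [abs_of_nonneg (sub_nonneg.2 (Nat.floor_le (hg0 _ (div_pos hk0 hx))))]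
    linarith [Nat.lt_floor_add_one (g (k / x))]
  have h4 := Nat.floor_le (hg0 _ hKx)
  have h5 : |∑' j, min (l j * x) K - x * ∫ v in Set.Ioc 0 (K / x), g v| ≤ K := by
    simp only [hmin]
    rw [tsum_mul_left, ← mul_sub, abs_mul, abs_of_pos hx]
    calc x * _ ≤ x * (K / x) := by gcongr
      _ = K := by field_simp
  rw [abs_le] at *
  constructor <;> linarith [h1.1, h1.2, h3.1, h3.2, h5.1, h5.2]

end FractalString

namespace FractalString

/-! ### The oscillating profile attached to a zero of zeta -/

/-- The profile `v ^ (-D) + β Re (v ^ (-s))`. -/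
noncomputable def profile (D β : ℝ) (s : ℂ) (v : ℝ) : ℝ :=
  ((v : ℂ) ^ (-(D : ℂ)) + β * (v : ℂ) ^ (-s)).re

lemma abs_profile_le {D β : ℝ} {s : ℂ} (hsD : s.re = D) {v : ℝ} (hv : 0 < v) :
    |profile D β s v| ≤ (1 + |β|) * v ^ (-D) := by
  refine (Complex.abs_re_le_norm _).trans ((norm_add_le _ _).trans (le_of_eq ?_))
  rw [norm_mul, Complex.norm_cpow_eq_rpow_re_of_pos hv, Complex.norm_cpow_eq_rpow_re_of_pos hv,
    Complex.norm_real, Real.norm_eq_abs]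
  simp [hsD]
  ring

lemma integrableOn_cpow_neg {s : ℂ} (hs1 : s.re < 1) {ε : ℝ} (hε : 0 < ε) :
    IntegrableOn (fun v : ℝ => (v : ℂ) ^ (-s)) (Set.Ioc 0 ε) := by
  rw [← intervalIntegrable_iff_integrableOn_Ioc_of_le hε.le]
  exact intervalIntegral.intervalIntegrable_cpow' (by simpa using hs1)

lemma integral_cpow_neg {s : ℂ} (hs1 : s.re < 1) {ε : ℝ} (hε : 0 < ε) :
    ∫ v in Set.Ioc 0 ε, (v : ℂ) ^ (-s) = (ε : ℂ) ^ (1 - s) / (1 - s) := by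
  have hs : (1 - s) ≠ 0 := fun h => by
    have := congrArg Complex.re h
    simp at this; linarith
  rw [← intervalIntegral.integral_of_le hε.le, integral_cpow (Or.inl (by simpa using hs1))]
  have h1 : -s + 1 = 1 - s := by ring
  rw [h1]
  simp [Complex.zero_cpow hs]

lemma integrableOn_profile {D β : ℝ} {s : ℂ} (hD : D < 1) (hsD : s.re = D) {ε : ℝ} (hε : 0 < ε) :
    IntegrableOn (profile D β s) (Set.Ioc 0 ε) := by
  have := ((integrableOn_cpow_neg (s := (D : ℂ)) (by simpa using hD) hε).add
    ((integrableOn_cpow_neg (s := s) (by linarith) hε).const_mul (β : ℂ))).re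
  exact this

lemma integral_profile {D β : ℝ} {s : ℂ} (hD : D < 1) (hsD : s.re = D) {ε : ℝ} (hε : 0 < ε) :
    ∫ v in Set.Ioc 0 ε, profile D β s v =
      ((ε : ℂ) ^ (1 - (D : ℂ)) / (1 - D) + β * ((ε : ℂ) ^ (1 - s) / (1 - s))).re := by
  have h1 := integrableOn_cpow_neg (s := (D : ℂ)) (by simpa using hD) hε
  have h2 := (integrableOn_cpow_neg (s := s) (by linarith) hε).const_mul (β : ℂ)
  have h3 : ∫ v in Set.Ioc 0 ε, profile D β s v = _ := integral_re (h1.add h2)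
  rw [h3]
  simp only [Pi.add_apply]
  rw [integral_add h1 h2, integral_const_mul, integral_cpow_neg (by simpa using hD) hε,
    integral_cpow_neg (by linarith) hε]
  rfl

lemma norm_truncation_add_zeta_le {s : ℂ} (hs : 0 < s.re) (hs1 : s.re < 1) {x : ℝ} (hx : 0 < x)
    {K : ℕ} (hK : 1 ≤ K) :
    ‖x * (((K / x : ℝ) : ℂ) ^ (1 - s) / (1 - s)) -
      ∑ k ∈ Finset.Icc 1 K, ((k / x : ℝ) : ℂ) ^ (-s) + riemannZeta s * (x : ℂ) ^ s‖ ≤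
      ‖s‖ / s.re * (x / K) ^ s.re := by
  have hKpos : (0 : ℝ) < K := by exact_mod_cast hK
  have hx0 : (x : ℂ) ≠ 0 := by exact_mod_cast hx.ne'
  have hdiv : ∀ (k : ℕ) (z : ℂ), ((k / x : ℝ) : ℂ) ^ z = (k : ℂ) ^ z * (x : ℂ) ^ (-z) := by
    intro k z
    rw [Complex.cpow_neg, ← div_eq_mul_inv, Complex.ofReal_div, ← Complex.ofReal_natCast,
      Complex.div_cpow_ofReal_nonneg (Nat.cast_nonneg k) hx.le]
  have e1 : (x : ℂ) ^ (-(1 - s)) = (x : ℂ) ^ s / x := by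
    rw [neg_sub, Complex.cpow_sub _ _ hx0, Complex.cpow_one]
  have e : x * (((K / x : ℝ) : ℂ) ^ (1 - s) / (1 - s)) -
      ∑ k ∈ Finset.Icc 1 K, ((k / x : ℝ) : ℂ) ^ (-s) + riemannZeta s * (x : ℂ) ^ s =
      -((x : ℂ) ^ s * (∑ k ∈ Finset.Icc 1 K, (k : ℂ) ^ (-s) - (K : ℂ) ^ (1 - s) / (1 - s) -
        riemannZeta s)) := by
    simp only [hdiv, neg_neg, ← Finset.sum_mul, e1]
    field_simp
    ring
  rw [e, norm_neg, norm_mul, Complex.norm_cpow_eq_rpow_re_of_pos hx]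
  refine (mul_le_mul_of_nonneg_left (norm_sum_cpow_sub_le hs hs1 hK)
    (Real.rpow_nonneg hx.le _)).trans (le_of_eq ?_)
  rw [Real.div_rpow hx.le hKpos.le, Real.rpow_neg hKpos.le]
  ring

lemma exists_abs_tsum_fract_sub_le_of_profile {D β r : ℝ} {s : ℂ} (hD : D ∈ Set.Ioo (0 : ℝ) 1)
    (hsD : s.re = D) (hζ : riemannZeta s = 0) (hr : riemannZeta D = -(r : ℂ))
    {l : ℕ → ℝ} (hpos : ∀ j, 0 < l j) (hl : Summable l)
    (hlg : ∀ v > 0, ∀ j : ℕ, v ≤ l j ↔ (j : ℝ) + 1 ≤ profile D β s v)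
    (hg0 : ∀ v > 0, 0 ≤ profile D β s v) :
    ∃ C, 0 ≤ C ∧ ∀ x : ℝ, 0 < x → ∀ K : ℕ, 1 ≤ K →
      |∑' j, Int.fract (l j * x) - r * x ^ D| ≤ 2 * K + C * (x / K) ^ D := by
  have hs0 : 0 < s.re := hsD ▸ hD.1
  have hs1 : s.re < 1 := hsD ▸ hD.2
  refine ⟨(1 + |β|) + (1 + |β| * (‖s‖ / D)), by have := hD.1; positivity, fun x hx K hK => ?_⟩
  have hKpos : (0 : ℝ) < K := by exact_mod_cast hK
  have hKx : 0 < K / x := div_pos hKpos hx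
  have h1 := abs_tsum_fract_sub_le hpos hl hlg hg0 hx hK (integrableOn_profile hD.2 hsD hKx)
  have h2 : profile D β s (K / x) ≤ (1 + |β|) * (x / K) ^ D := by
    refine (le_abs_self _).trans ((abs_profile_le hsD hKx).trans (le_of_eq ?_))
    rw [Real.rpow_neg hKx.le, ← Real.inv_rpow hKx.le, inv_div]
  have hA := norm_truncation_add_zeta_le (s := (D : ℂ)) (by simpa using hD.1) (by simpa using hD.2)
    hx hK
  have hB := norm_truncation_add_zeta_le hs0 hs1 hx hK
  rw [hζ, zero_mul, add_zero, hsD] at hB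
  set A : ℂ := x * (((K / x : ℝ) : ℂ) ^ (1 - (D : ℂ)) / (1 - D)) -
      ∑ k ∈ Finset.Icc 1 K, ((k / x : ℝ) : ℂ) ^ (-(D : ℂ)) + riemannZeta D * (x : ℂ) ^ (D : ℂ)
    with hAdef
  set B : ℂ := x * (((K / x : ℝ) : ℂ) ^ (1 - s) / (1 - s)) -
      ∑ k ∈ Finset.Icc 1 K, ((k / x : ℝ) : ℂ) ^ (-s) with hBdef
  have h3 : x * (∫ v in Set.Ioc 0 (K / x), profile D β s v) -
      ∑ k ∈ Finset.Icc 1 K, profile D β s (k / x) - r * x ^ D = (A + β * B).re := by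
    have e1 : ∑ k ∈ Finset.Icc 1 K, profile D β s (k / x) =
        (∑ k ∈ Finset.Icc 1 K, ((k / x : ℝ) : ℂ) ^ (-(D : ℂ)) +
          β * ∑ k ∈ Finset.Icc 1 K, ((k / x : ℝ) : ℂ) ^ (-s)).re := by
      rw [Finset.mul_sum, ← Finset.sum_add_distrib, Complex.re_sum]
      rfl
    have e2 : r * x ^ D = (-(riemannZeta D * (x : ℂ) ^ (D : ℂ))).re := by
      rw [hr, ← Complex.ofReal_cpow hx.le, neg_mul, neg_neg, ← Complex.ofReal_mul,
        Complex.ofReal_re]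
    rw [integral_profile hD.2 hsD hKx, e1, e2, ← Complex.re_ofReal_mul, ← Complex.sub_re,
      ← Complex.sub_re]
    congr 1
    rw [hAdef, hBdef]
    ring
  have h4 : |(A + β * B).re| ≤ (1 + |β| * (‖s‖ / D)) * (x / K) ^ D := by
    refine (Complex.abs_re_le_norm _).trans ((norm_add_le _ _).trans ?_)
    rw [norm_mul, Complex.norm_real, Real.norm_eq_abs]
    have hA' : ‖A‖ ≤ (x / K) ^ D := by
      refine hA.trans (le_of_eq ?_)
      rw [Complex.norm_real, Real.norm_of_nonneg hD.1.le, Complex.ofReal_re, div_self hD.1.ne',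
        one_mul]
    have := mul_le_mul_of_nonneg_left hB (abs_nonneg β)
    nlinarith
  rw [← h3] at h4
  rw [abs_le] at *
  constructor <;> nlinarith [h1.1, h1.2, h4.1, h4.2]

end FractalString

namespace FractalString

/-! ### Strings realizing the oscillating profile -/

lemma profile_eq {D β : ℝ} {s : ℂ} (hsD : s.re = D) {v : ℝ} (hv : 0 < v) :
    profile D β s v = v ^ (-D) * (1 + β * Real.cos (s.im * Real.log v)) := by
  have hv0 : (v : ℂ) ≠ 0 := by exact_mod_cast hv.ne'
  rw [profile, Complex.add_re, Complex.re_ofReal_mul, Complex.cpow_def_of_ne_zero hv0,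
    Complex.cpow_def_of_ne_zero hv0, Complex.exp_re, Complex.exp_re, ← Complex.ofReal_log hv.le,
    Real.rpow_def_of_pos hv]
  have h1 : Real.log v * -s.im = -(s.im * Real.log v) := by ring
  simp only [Complex.re_ofReal_mul, Complex.im_ofReal_mul, Complex.neg_re, Complex.neg_im,
    Complex.ofReal_re, Complex.ofReal_im, hsD, h1, neg_zero, mul_zero, Real.cos_zero, Real.cos_neg]
  ring

lemma half_rpow_le_profile {D β : ℝ} {s : ℂ} (hsD : s.re = D) (hβ0 : 0 ≤ β) (hβ : β ≤ 1 / 2)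
    {v : ℝ} (hv : 0 < v) : v ^ (-D) / 2 ≤ profile D β s v := by
  rw [profile_eq hsD hv]
  have h1 := Real.neg_one_le_cos (s.im * Real.log v)
  have h2 := Real.rpow_pos_of_pos hv (-D)
  have h3 : 1 / 2 ≤ 1 + β * Real.cos (s.im * Real.log v) := by nlinarith
  nlinarith

lemma profile_le_two_mul_rpow {D β : ℝ} {s : ℂ} (hsD : s.re = D) (hβ0 : 0 ≤ β) (hβ : β ≤ 1 / 2)
    {v : ℝ} (hv : 0 < v) : profile D β s v ≤ 2 * v ^ (-D) := by
  rw [profile_eq hsD hv]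
  have h1 := Real.cos_le_one (s.im * Real.log v)
  have h2 := Real.rpow_pos_of_pos hv (-D)
  have h3 : 1 + β * Real.cos (s.im * Real.log v) ≤ 2 := by nlinarith
  nlinarith

lemma profile_exp_neg {D β : ℝ} {s : ℂ} (hsD : s.re = D) (t : ℝ) :
    profile D β s (Real.exp (-t)) = Real.exp (D * t) * (1 + β * Real.cos (s.im * t)) := by
  rw [profile_eq hsD (Real.exp_pos _), Real.log_exp, ← Real.exp_mul, mul_neg s.im, Real.cos_neg]
  congr 2
  ring

lemma strictMono_profile_exp_neg {D β : ℝ} {s : ℂ} (hD : 0 ≤ D) (hsD : s.re = D) (hβ0 : 0 ≤ β)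
    (hβ : β * (D + |s.im|) < D) :
    StrictMono fun t : ℝ => profile D β s (Real.exp (-t)) := by
  simp only [profile_exp_neg hsD]
  refine strictMono_of_deriv_pos fun t => ?_
  have h : HasDerivAt (fun t : ℝ => Real.exp (D * t) * (1 + β * Real.cos (s.im * t)))
      (Real.exp (D * t) * (D * (1 + β * Real.cos (s.im * t)) - β * s.im * Real.sin (s.im * t)))
      t := by
    have h1 : HasDerivAt (fun t : ℝ => D * t) D t := by
      simpa using (hasDerivAt_id t).const_mul D
    have h2 : HasDerivAt (fun t : ℝ => s.im * t) s.im t := by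
      simpa using (hasDerivAt_id t).const_mul s.im
    have h3 := h1.exp.mul ((h2.cos.const_mul β).const_add 1)
    exact h3.congr_deriv (by ring)
  rw [h.deriv]
  refine mul_pos (Real.exp_pos _) ?_
  have h1 := Real.neg_one_le_cos (s.im * t)
  have h2 : s.im * Real.sin (s.im * t) ≤ |s.im| := by
    refine (le_abs_self _).trans ?_
    rw [abs_mul]
    exact mul_le_of_le_one_right (abs_nonneg _) (Real.abs_sin_le_one _)
  nlinarith [mul_le_mul_of_nonneg_left h2 hβ0, mul_nonneg hβ0 hD,
    mul_le_mul_of_nonneg_left h1 (mul_nonneg hβ0 hD)]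

lemma exists_lengths_of_profile {D β : ℝ} {s : ℂ} (hD : 0 < D) (hsD : s.re = D) (hβ0 : 0 ≤ β)
    (hβ2 : β ≤ 1 / 2) (hβ : β * (D + |s.im|) < D) :
    ∃ l : ℕ → ℝ, (∀ j, 0 < l j) ∧
      ∀ v > 0, ∀ j : ℕ, v ≤ l j ↔ (j : ℝ) + 1 ≤ profile D β s v := by
  have hmono := strictMono_profile_exp_neg hD.le hsD hβ0 hβ
  have hcont : Continuous fun t : ℝ => profile D β s (Real.exp (-t)) := by
    simp only [profile_exp_neg hsD]
    fun_prop
  have hex : ∀ j : ℕ, ∃ t : ℝ, profile D β s (Real.exp (-t)) = (j : ℝ) + 1 := by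
    intro j
    have hj : (0 : ℝ) < (j : ℝ) + 1 := by positivity
    have hrp : ∀ u > 0, Real.exp (-(Real.log u / D)) ^ (-D) = u := by
      intro u hu
      rw [← Real.exp_mul]
      have : -(Real.log u / D) * -D = Real.log u := by field_simp
      rw [this, Real.exp_log hu]
    have hlo : profile D β s (Real.exp (-(Real.log (((j : ℝ) + 1) / 2) / D))) ≤ (j : ℝ) + 1 := by
      have := profile_le_two_mul_rpow hsD hβ0 hβ2
        (Real.exp_pos (-(Real.log (((j : ℝ) + 1) / 2) / D)))
      rw [hrp _ (by positivity)] at this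
      linarith
    have hhi : (j : ℝ) + 1 ≤ profile D β s (Real.exp (-(Real.log (2 * ((j : ℝ) + 1)) / D))) := by
      have := half_rpow_le_profile hsD hβ0 hβ2
        (Real.exp_pos (-(Real.log (2 * ((j : ℝ) + 1)) / D)))
      rw [hrp _ (by positivity)] at this
      linarith
    exact mem_range_of_exists_le_of_exists_ge hcont ⟨_, hlo⟩ ⟨_, hhi⟩
  choose t ht using hex
  refine ⟨fun j => Real.exp (-t j), fun j => Real.exp_pos _, fun v hv j => ?_⟩
  have hv' : v = Real.exp (-(-Real.log v)) := by rw [neg_neg, Real.exp_log hv]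
  rw [← ht j, hv', Real.exp_le_exp, neg_le_neg_iff]
  exact (hmono.le_iff_le (a := t j) (b := -Real.log v)).symm

section Lengths

variable {D β : ℝ} {s : ℂ} {l : ℕ → ℝ}

lemma rpow_le_of_profile (hsD : s.re = D) (hβ0 : 0 ≤ β)
    (hβ2 : β ≤ 1 / 2) (hpos : ∀ j, 0 < l j)
    (hlg : ∀ v > 0, ∀ j : ℕ, v ≤ l j ↔ (j : ℝ) + 1 ≤ profile D β s v) (j : ℕ) :
    l j ^ D ≤ 2 / ((j : ℝ) + 1) := by
  have h1 := ((hlg _ (hpos j) j).1 le_rfl).trans (profile_le_two_mul_rpow hsD hβ0 hβ2 (hpos j))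
  have h2 := Real.rpow_pos_of_pos (hpos j) D
  rw [Real.rpow_neg (hpos j).le] at h1
  rw [le_div_iff₀ (by positivity)]
  have h3 := mul_le_mul_of_nonneg_left h1 h2.le
  have h4 : l j ^ D * (2 * (l j ^ D)⁻¹) = 2 := by field_simp
  linarith

lemma le_rpow_of_profile (hD : 0 < D) (hsD : s.re = D) (hβ0 : 0 ≤ β)
    (hβ2 : β ≤ 1 / 2)
    (hlg : ∀ v > 0, ∀ j : ℕ, v ≤ l j ↔ (j : ℝ) + 1 ≤ profile D β s v) (j : ℕ) :
    1 / (2 * ((j : ℝ) + 1)) ≤ l j ^ D := by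
  have hp : (0 : ℝ) < 1 / (2 * ((j : ℝ) + 1)) := by positivity
  have hv : 0 < (1 / (2 * ((j : ℝ) + 1))) ^ (1 / D) := Real.rpow_pos_of_pos hp _
  have hvD : ((1 / (2 * ((j : ℝ) + 1))) ^ (1 / D)) ^ D = 1 / (2 * ((j : ℝ) + 1)) := by
    rw [← Real.rpow_mul hp.le, one_div_mul_cancel hD.ne', Real.rpow_one]
  have h1 := half_rpow_le_profile hsD hβ0 hβ2 hv
  rw [Real.rpow_neg hv.le, hvD] at h1
  have h2 := (hlg _ hv j).2 (by
    refine le_trans (le_of_eq ?_) h1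
    field_simp)
  rw [← hvD]
  exact Real.rpow_le_rpow hv.le h2 hD.le

lemma antitone_of_profile (hpos : ∀ j, 0 < l j)
    (hlg : ∀ v > 0, ∀ j : ℕ, v ≤ l j ↔ (j : ℝ) + 1 ≤ profile D β s v) : Antitone l := by
  refine antitone_nat_of_succ_le fun j => (hlg _ (hpos _) j).2 ?_
  have := (hlg _ (hpos (j + 1)) (j + 1)).1 le_rfl
  push_cast at this
  linarith

lemma summable_rpow_iff_of_profile (hD : 0 < D) (hsD : s.re = D) (hβ0 : 0 ≤ β)
    (hβ2 : β ≤ 1 / 2) (hpos : ∀ j, 0 < l j)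
    (hlg : ∀ v > 0, ∀ j : ℕ, v ≤ l j ↔ (j : ℝ) + 1 ≤ profile D β s v) (σ : ℝ) :
    (Summable fun j => l j ^ σ) ↔ D < σ := by
  have hup := rpow_le_of_profile hsD hβ0 hβ2 hpos hlg
  have hdown := le_rpow_of_profile hD hsD hβ0 hβ2 hlg
  constructor
  · intro h
    by_contra! hσ
    have h1 : Summable fun j => l (j + 1) ^ σ := (summable_nat_add_iff 1).2 h
    have h2 : Summable fun j : ℕ => 1 / (2 * (((j + 1 : ℕ) : ℝ) + 1)) := by
      refine Summable.of_nonneg_of_le (fun j => by positivity) (fun j => ?_) h1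
      refine (hdown (j + 1)).trans (Real.rpow_le_rpow_of_exponent_ge (hpos _) ?_ hσ)
      have h3 := hup (j + 1)
      have h4 : 2 / (((j + 1 : ℕ) : ℝ) + 1) ≤ 1 := by
        rw [div_le_one (by positivity)]
        push_cast
        have : (0 : ℝ) ≤ j := Nat.cast_nonneg j
        linarith
      by_contra! h5
      have := Real.one_lt_rpow h5 hD
      linarith
    refine Real.not_summable_one_div_natCast ((summable_nat_add_iff 2).1 ?_)
    refine (h2.mul_left 2).congr fun j => ?_
    push_cast
    field_simp
    ring
  · intro hσ
    have h1 : Summable fun j : ℕ => (2 : ℝ) ^ (σ / D) * (1 / ((j : ℝ) + 1) ^ (σ / D)) := by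
      refine Summable.mul_left _ ?_
      have := (summable_nat_add_iff 1).2
        (Real.summable_one_div_nat_rpow.2 ((one_lt_div hD).2 hσ))
      simpa using this
    refine Summable.of_nonneg_of_le (fun j => (Real.rpow_pos_of_pos (hpos j) σ).le)
      (fun j => ?_) h1
    have h2 := Real.rpow_le_rpow (Real.rpow_pos_of_pos (hpos j) D).le (hup j)
      (div_pos (hD.trans hσ) hD).le
    rw [← Real.rpow_mul (hpos j).le, mul_div_cancel₀ _ hD.ne',
      Real.div_rpow zero_le_two (by positivity)] at h2
    rwa [mul_one_div]

end Lengths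

/-- The string with consecutive intervals of prescribed lengths. -/
noncomputable def ofLengths (l : ℕ → ℝ) (hpos : ∀ j, 0 < l j) (hl : Summable l)
    (hanti : Antitone l) : FractalString where
  a j := ∑ i ∈ Finset.range j, l i
  b j := ∑ i ∈ Finset.range (j + 1), l i
  lt j := by
    rw [Finset.sum_range_succ]
    linarith [hpos j]
  disj := by
    have hm : Monotone fun j => ∑ i ∈ Finset.range j, l i :=
      monotone_nat_of_le_succ fun j => by
        rw [Finset.sum_range_succ]
        linarith [hpos j]
    have key : ∀ i j, i < j → Disjoint
        (Set.Ioo (∑ k ∈ Finset.range i, l k) (∑ k ∈ Finset.range (i + 1), l k))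
        (Set.Ioo (∑ k ∈ Finset.range j, l k) (∑ k ∈ Finset.range (j + 1), l k)) := by
      intro i j hij
      rw [Set.disjoint_left]
      intro x hx hx'
      have := hm (show i + 1 ≤ j from hij)
      simp only at this
      linarith [hx.2, hx'.1]
    intro i j hij
    rcases lt_or_gt_of_ne hij with h | h
    · exact key i j h
    · exact (key j i h).symm
  bdd := by
    refine (Metric.isBounded_Icc (0 : ℝ) (∑' j, l j)).subset (Set.iUnion_subset fun j x hx => ?_)
    exact ⟨(Finset.sum_nonneg fun i _ => (hpos i).le).trans hx.1.le,
      hx.2.le.trans (hl.sum_le_tsum _ fun i _ => (hpos i).le)⟩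
  anti := by
    intro i j hij
    simp only [Finset.sum_range_succ, add_sub_cancel_left]
    exact hanti hij

lemma l_ofLengths (l : ℕ → ℝ) (hpos : ∀ j, 0 < l j) (hl : Summable l) (hanti : Antitone l) :
    (ofLengths l hpos hl hanti).l = l := by
  ext j
  simp [FractalString.l, ofLengths, Finset.sum_range_succ]

end FractalString

namespace FractalString

lemma isBigO_tsum_fract_sub_of_forall_nat {l : ℕ → ℝ} {D r C : ℝ} (hD : 0 < D) (hC : 0 ≤ C)
    (h : ∀ x : ℝ, 0 < x → ∀ K : ℕ, 1 ≤ K →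
      |∑' j, Int.fract (l j * x) - r * x ^ D| ≤ 2 * K + C * (x / K) ^ D) :
    (fun x : ℝ => ∑' j, Int.fract (l j * x) - r * x ^ D) =O[atTop]
      fun x : ℝ => x ^ (D / (1 + D)) := by
  refine IsBigO.of_bound (4 + C) ?_
  filter_upwards [eventually_ge_atTop (1 : ℝ)] with x hx
  have hx0 : 0 < x := by linarith
  set y := x ^ (D / (1 + D)) with hy
  have hy1 : 1 ≤ y := Real.one_le_rpow hx (by positivity)
  have hK : 1 ≤ ⌈y⌉₊ := Nat.one_le_ceil_iff.2 (by linarith)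
  have hK1 : y ≤ ⌈y⌉₊ := Nat.le_ceil y
  have hK2 : (⌈y⌉₊ : ℝ) ≤ 2 * y := by linarith [(Nat.ceil_lt_add_one (by linarith : 0 ≤ y)).le]
  have hxy : (x / ⌈y⌉₊) ^ D ≤ y := by
    refine (Real.rpow_le_rpow (by positivity)
      (div_le_div_of_nonneg_left hx0.le (by linarith) hK1) hD.le).trans (le_of_eq ?_)
    rw [Real.div_rpow hx0.le (by linarith), hy, ← Real.rpow_mul hx0.le, ← Real.rpow_sub hx0]
    congr 1
    field_simp
    ring
  rw [Real.norm_eq_abs, Real.norm_eq_abs, abs_of_nonneg (by linarith : 0 ≤ y)]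
  refine (h x hx0 _ hK).trans ?_
  have := mul_le_mul_of_nonneg_left hxy hC
  linarith

lemma rpow_mul_integral_profile {D β : ℝ} {s : ℂ} (hD : D < 1) (hsD : s.re = D)
    (hτ : s.im ≠ 0) (n : ℕ) {ε : ℝ} (hε : ε = Real.exp (-(n * (Real.pi / |s.im|)))) :
    ∫ v in Set.Ioc 0 ε, profile D β s v =
      ε ^ (1 - D) * (1 / (1 - D) + β * (-1) ^ n * (1 / (1 - s)).re) := by
  have hε0 : 0 < ε := hε ▸ Real.exp_pos _
  have hεc : (ε : ℂ) ≠ 0 := by exact_mod_cast hε0.ne'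
  rw [integral_profile hD hsD hε0]
  have h1 : (ε : ℂ) ^ (1 - (D : ℂ)) = ((ε ^ (1 - D) : ℝ) : ℂ) := by
    rw [Complex.ofReal_cpow hε0.le]
    push_cast
    rfl
  have h2 : (ε : ℂ) ^ (1 - s) = ((ε ^ (1 - D) : ℝ) : ℂ) * (((-1) ^ n : ℝ) : ℂ) := by
    have h3 : (1 - s) = (1 - (D : ℂ)) + (-(s.im * Complex.I)) := by
      apply Complex.ext <;> simp [hsD]
    have h4 : (ε : ℂ) ^ (-(s.im * Complex.I)) = (((-1) ^ n : ℝ) : ℂ) := by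
      rw [Complex.cpow_def_of_ne_zero hεc, ← Complex.ofReal_log hε0.le, hε, Real.log_exp]
      have hτc : (s.im : ℂ) ≠ 0 := by exact_mod_cast hτ
      have h5 : ((-(n * (Real.pi / |s.im|)) : ℝ) : ℂ) * (-(s.im * Complex.I)) =
          (n : ℂ) * (Real.pi * Complex.I) ∨
          ((-(n * (Real.pi / |s.im|)) : ℝ) : ℂ) * (-(s.im * Complex.I)) =
          (n : ℂ) * (-(Real.pi * Complex.I)) := by
        rcases abs_choice s.im with h | h
        · left
          rw [h]
          push_cast
          field_simp
        · right
          rw [h]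
          push_cast
          field_simp
      rcases h5 with h5 | h5
      · rw [h5, Complex.exp_nat_mul, Complex.exp_pi_mul_I]
        push_cast
        rfl
      · rw [h5, Complex.exp_nat_mul, Complex.exp_neg, Complex.exp_pi_mul_I, inv_neg_one]
        push_cast
        rfl
    rw [h3, Complex.cpow_add _ _ hεc, h1, h4]
  rw [h1, h2]
  have h6 : (((ε ^ (1 - D) : ℝ) : ℂ) / (1 - (D : ℂ)) +
      β * (((ε ^ (1 - D) : ℝ) : ℂ) * (((-1) ^ n : ℝ) : ℂ) / (1 - s))) =
      ((ε ^ (1 - D) / (1 - D) : ℝ) : ℂ) +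
        ((β * (ε ^ (1 - D) * (-1) ^ n) : ℝ) : ℂ) * (1 / (1 - s)) := by
    push_cast
    ring
  rw [h6, Complex.add_re, Complex.ofReal_re, Complex.re_ofReal_mul]
  ring

/-- A string whose lengths follow the oscillating profile is not Minkowski measurable. -/
lemma not_minkowskiMeasurable_of_profile (S : FractalString) {D β : ℝ} {s : ℂ}
    (hD : D ∈ Set.Ioo (0 : ℝ) 1) (hsD : s.re = D) (hτ : s.im ≠ 0) (hβ0 : 0 < β) (hβ2 : β ≤ 1 / 2)
    (hlg : ∀ v > 0, ∀ j : ℕ, v ≤ S.l j ↔ (j : ℝ) + 1 ≤ profile D β s v) :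
    ¬ S.MinkowskiMeasurable D := by
  rintro ⟨M, -, hM⟩
  have hg0 : ∀ v > 0, 0 ≤ profile D β s v := fun v hv =>
    (by positivity : 0 ≤ v ^ (-D) / 2).trans (half_rpow_le_profile hsD hβ0.le hβ2 hv)
  set η : ℕ → ℝ := fun n => Real.exp (-(n * (Real.pi / |s.im|))) with hη
  have hη0 : ∀ n, 0 < η n := fun n => Real.exp_pos _
  have hηlim : Tendsto η atTop (𝓝 0) := by
    refine Real.tendsto_exp_neg_atTop_nhds_zero.comp ?_
    exact tendsto_natCast_atTop_atTop.atTop_mul_const (div_pos Real.pi_pos (abs_pos.2 hτ))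
  have hlim : Tendsto (fun n => (volume (S.innerNbhd (η n / 2))).toReal / (η n / 2) ^ (1 - D))
      atTop (𝓝 M) := by
    refine Tendsto.comp hM (tendsto_nhdsWithin_iff.2 ⟨?_, Eventually.of_forall fun n => ?_⟩)
    · simpa using hηlim.div_const 2
    · exact half_pos (hη0 n)
  set q : ℝ := (1 / (1 - s)).re with hq
  have hq0 : 0 < q := by
    have hre : (1 - s).re = 1 - D := by simp [hsD]
    have h1 : 0 < (1 - s).re := by rw [hre]; linarith [hD.2]
    have hne : (1 - s) ≠ 0 := fun h => by rw [h] at h1; simp at h1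
    rw [hq, one_div, Complex.inv_re]
    exact div_pos h1 (Complex.normSq_pos.2 hne)
  have hclose : Tendsto (fun n => (volume (S.innerNbhd (η n / 2))).toReal / (η n) ^ (1 - D) -
      (1 / (1 - D) + β * (-1) ^ n * q)) atTop (𝓝 0) := by
    have hηD : Tendsto (fun n => (η n) ^ D) atTop (𝓝 0) := by
      have := (Real.continuousAt_rpow_const 0 D (Or.inr hD.1.le)).tendsto.comp hηlim
      rwa [Real.zero_rpow hD.1.ne'] at this
    refine squeeze_zero_norm (fun n => ?_) hηD
    have hp := Real.rpow_pos_of_pos (hη0 n) (1 - D)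
    have h1 := abs_tsum_min_sub_integral_le S.l_pos S.summable_l hlg hg0 (hη0 n)
      (integrableOn_profile (β := β) hD.2 hsD (hη0 n))
    rw [rpow_mul_integral_profile hD.2 hsD hτ n rfl] at h1
    rw [S.volume_innerNbhd (half_pos (hη0 n)), mul_div_cancel₀ _ two_ne_zero, Real.norm_eq_abs]
    have h2 : (∑' j, min (S.l j) (η n)) / η n ^ (1 - D) - (1 / (1 - D) + β * (-1) ^ n * q) =
        (∑' j, min (S.l j) (η n) - η n ^ (1 - D) * (1 / (1 - D) + β * (-1) ^ n * q)) /
          η n ^ (1 - D) := by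
      field_simp
    rw [h2, abs_div, abs_of_pos hp, div_le_iff₀ hp, ← Real.rpow_add (hη0 n)]
    rw [add_sub_cancel, Real.rpow_one]
    exact h1
  have hlim2 : Tendsto (fun n => (volume (S.innerNbhd (η n / 2))).toReal / (η n) ^ (1 - D))
      atTop (𝓝 (M / 2 ^ (1 - D))) := by
    refine (hlim.div_const (2 ^ (1 - D))).congr fun n => ?_
    rw [Real.div_rpow (hη0 n).le zero_le_two]
    have := Real.rpow_pos_of_pos (hη0 n) (1 - D)
    have := Real.rpow_pos_of_pos zero_lt_two (1 - D)
    field_simp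
  have hosc := (hlim2.sub hclose).sub_const (1 / (1 - D))
  simp only [sub_sub_cancel, add_sub_cancel_left, sub_zero] at hosc
  have heven : Tendsto (fun n : ℕ => β * (-1) ^ (2 * n) * q) atTop _ :=
    hosc.comp (tendsto_id.const_mul_atTop' (zero_lt_two : (0 : ℕ) < 2))
  have hodd : Tendsto (fun n : ℕ => β * (-1) ^ (2 * n + 1) * q) atTop _ :=
    hosc.comp ((tendsto_add_atTop_nat 1).comp
      (tendsto_id.const_mul_atTop' (zero_lt_two : (0 : ℕ) < 2)))
  simp only [pow_succ, pow_mul, pow_zero, mul_neg, neg_neg, mul_one, one_pow,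
    tendsto_const_nhds_iff] at heven hodd
  have : 0 < β * q := mul_pos hβ0 hq0
  linarith

/-- A zero of zeta in the critical strip yields a string violating the inverse spectral
problem in the dimension of its real part. -/
theorem exists_not_minkowskiMeasurable_of_riemannZeta_eq_zero {s : ℂ} (hζ : riemannZeta s = 0)
    (hs : 0 < s.re) (hs1 : s.re < 1) :
    ∃ S : FractalString, S.dimension = s.re ∧
      (∃ cD : ℝ, 0 < cD ∧ ∃ δ : ℝ, 0 < δ ∧
        (fun x : ℝ => S.Nnu x - (S.weyl x - cD * x ^ s.re)) =O[atTop]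
          fun x : ℝ => x ^ (s.re - δ)) ∧ ¬ S.MinkowskiMeasurable s.re := by
  obtain ⟨r, hr0, hr⟩ := exists_riemannZeta_eq_neg ⟨hs, hs1⟩
  have hτ : s.im ≠ 0 := by
    intro h
    have hsr : s = (s.re : ℂ) := by apply Complex.ext <;> simp [h]
    rw [hsr, hr] at hζ
    have : (r : ℂ) = 0 := by simpa using hζ
    exact hr0.ne' (by exact_mod_cast this)
  set D := s.re with hDdef
  have hD : D ∈ Set.Ioo (0 : ℝ) 1 := ⟨hs, hs1⟩
  have hDτ : 0 < D + |s.im| := by positivity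
  set β := D / (2 * (D + |s.im|)) with hβdef
  have hβ0 : 0 < β := by positivity
  have hβ2 : β ≤ 1 / 2 := by
    rw [hβdef, div_le_div_iff₀ (by positivity) (by positivity)]
    linarith [abs_nonneg s.im]
  have hβ : β * (D + |s.im|) < D := by
    have : β * (D + |s.im|) = D / 2 := by rw [hβdef]; field_simp
    linarith
  obtain ⟨l, hpos, hlg⟩ := exists_lengths_of_profile hs hDdef.symm hβ0.le hβ2 hβ
  have hsum := summable_rpow_iff_of_profile hs hDdef.symm hβ0.le hβ2 hpos hlg
  have hl : Summable l := by simpa using (hsum 1).2 hs1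
  have hlS := l_ofLengths l hpos hl (antitone_of_profile hpos hlg)
  set S := ofLengths l hpos hl (antitone_of_profile hpos hlg)
  refine ⟨S, ?_, ⟨r, hr0, D - D / (1 + D), ?_, ?_⟩, ?_⟩
  · have : {σ : ℝ | Summable fun j => S.l j ^ σ} = Set.Ioi D := by
      ext σ
      rw [hlS]
      exact hsum σ
    rw [dimension, this, csInf_Ioi]
  · rw [sub_pos, div_lt_iff₀ (by positivity)]
    nlinarith
  · obtain ⟨C, hC, h⟩ := exists_abs_tsum_fract_sub_le_of_profile hD hDdef.symm hζ hr hpos hl hlg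
      fun v hv => (by positivity : 0 ≤ v ^ (-D) / 2).trans
        (half_rpow_le_profile hDdef.symm hβ0.le hβ2 hv)
    have h1 := isBigO_tsum_fract_sub_of_forall_nat hs hC h
    rw [sub_sub_cancel]
    refine h1.neg_left.congr' ?_ EventuallyEq.rfl
    filter_upwards [eventually_gt_atTop (0 : ℝ)] with x hx
    have h2 := (S.weyl_sub_Nnu hx).2
    rw [hlS] at h2
    rw [← h2]
    ring
  · rw [← hlS] at hlg
    exact S.not_minkowskiMeasurable_of_profile hD hDdef.symm hτ hβ0 hβ2 hlg

end FractalString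

/-! ### A Tauberian theorem of Wiener type -/

section Wiener

open scoped FourierTransform SchwartzMap ContDiff

/-- Convolving with an inverse Fourier transform amounts to multiplying Fourier transforms. -/
lemma integral_fourierInv_sub_mul {k φ : ℝ → ℂ} (hk : Integrable k) (hφ : Integrable φ) (t : ℝ) :
    ∫ u, 𝓕⁻ k (t - u) * φ u = ∫ ξ, (Real.fourierChar (ξ * t) : ℂ) * (k ξ * 𝓕 φ ξ) := by
  have hk' : Integrable fun ξ => (Real.fourierChar (ξ * t) : ℂ) * k ξ := by
    have := (Real.fourierIntegral_convergent_iff (μ := volume) (f := k) (-t)).2 hk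
    refine this.congr (Eventually.of_forall fun ξ => ?_)
    simp [Circle.smul_def, mul_comm]
  have h1 := VectorFourier.integral_fourierIntegral_smul_eq_flip (L := innerₗ ℝ)
    Real.continuous_fourierChar continuous_inner hk' hφ
  have h2 : ∀ u, VectorFourier.fourierIntegral Real.fourierChar volume (innerₗ ℝ)
      (fun ξ => (Real.fourierChar (ξ * t) : ℂ) * k ξ) u = 𝓕⁻ k (t - u) := by
    intro u
    rw [VectorFourier.fourierIntegral, Real.fourierInv_eq]
    refine integral_congr_ae (Eventually.of_forall fun ξ => ?_)
    simp only [innerₗ_apply_apply, RCLike.inner_apply, conj_trivial, Circle.smul_def, smul_eq_mul]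
    rw [← mul_assoc, ← Circle.coe_mul, ← AddChar.map_add_eq_mul]
    congr 3
    ring
  simp only [h2, smul_eq_mul] at h1
  rw [h1]
  refine integral_congr_ae (Eventually.of_forall fun ξ => ?_)
  simp only [mul_assoc]
  congr 2
  simp [VectorFourier.fourierIntegral, Real.fourier_eq]

lemma measurable_of_hasSum_translates {φ : ℝ → ℝ} (hφm : Measurable φ)
    {w b : ℕ → ℝ} {e : ℝ → ℝ} (he : ∀ t, HasSum (fun j => w j * φ (t - b j)) (e t)) :
    Measurable e := by
  refine measurable_of_tendsto_metrizable
    (f := fun n u => ∑ j ∈ Finset.range n, w j * φ (u - b j))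
    (fun n => Finset.measurable_fun_sum _ fun j _ =>
      (hφm.comp (measurable_id.sub_const _)).const_mul _) ?_
  exact tendsto_pi_nhds.2 fun u => (he u).tendsto_sum_nat

/-- Convolution of an integrable kernel with a bounded superposition of translates of a
nonnegative function, computed term by term. -/
lemma hasSum_integral_mul_of_hasSum_translates {K : ℝ → ℂ} (hK : Integrable K)
    {φ : ℝ → ℝ} (hφ0 : ∀ t, 0 ≤ φ t) (hφm : Measurable φ)
    {w b : ℕ → ℝ} (hw : ∀ j, 0 ≤ w j) {e : ℝ → ℝ}
    (he : ∀ t, HasSum (fun j => w j * φ (t - b j)) (e t)) {M : ℝ} (heM : ∀ t, e t ≤ M) (t : ℝ) :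
    HasSum (fun j => (w j : ℂ) * ∫ u, K (t - b j - u) * φ u) (∫ u, K (t - u) * e u) := by
  have he0 : ∀ t, 0 ≤ e t := fun t => (he t).nonneg fun j => mul_nonneg (hw j) (hφ0 _)
  have hKt : Integrable fun u => K (t - u) := hK.comp_sub_left t
  have hmeas : ∀ j, Measurable fun u => w j * φ (u - b j) := fun j =>
    (hφm.comp (measurable_id.sub_const _)).const_mul _
  have hem := measurable_of_hasSum_translates hφm he
  have key := hasSum_integral_of_dominated_convergence (μ := volume)
    (F := fun j u => K (t - u) * ((w j * φ (u - b j) : ℝ) : ℂ))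
    (f := fun u => K (t - u) * (e u : ℂ))
    (fun j u => ‖K (t - u)‖ * (w j * φ (u - b j)))
    (fun j => hKt.aestronglyMeasurable.mul
      (Complex.measurable_ofReal.comp (hmeas j)).aestronglyMeasurable)
    (fun j => Eventually.of_forall fun u => by
      rw [norm_mul, Complex.norm_real, Real.norm_of_nonneg (mul_nonneg (hw j) (hφ0 _))])
    (Eventually.of_forall fun u => ((he u).mul_left _).summable)
    (by
      simp_rw [fun u => ((he u).mul_left ‖K (t - u)‖).tsum_eq]
      refine hKt.norm.mul_bdd (c := M) hem.aestronglyMeasurable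
        (Eventually.of_forall fun u => ?_)
      rw [Real.norm_of_nonneg (he0 u)]
      exact heM u)
    (Eventually.of_forall fun u => (Complex.hasSum_ofReal.2 (he u)).mul_left _)
  refine Eq.mp (congrArg (HasSum · _) (funext fun j => ?_)) key
  rw [← integral_const_mul, ← integral_sub_right_eq_self (fun u => (w j : ℂ) * (K (t - b j - u) * φ u)) (b j)]
  refine integral_congr_ae (Eventually.of_forall fun u => ?_)
  simp only [sub_sub, add_sub_cancel]
  push_cast
  ring

lemma integral_fourierInv (k : 𝓢(ℝ, ℂ)) : ∫ u, 𝓕⁻ (k : ℝ → ℂ) u = k 0 := by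
  have h : 𝓕 (𝓕⁻ k) = k := FourierTransform.fourier_fourierInv_eq k
  have h0 := congrArg (fun f : 𝓢(ℝ, ℂ) => f 0) h
  simp only [SchwartzMap.fourier_coe, SchwartzMap.fourierInv_coe] at h0
  rw [← h0, Real.fourier_real_eq]
  simp

lemma integrable_fourierInv (k : 𝓢(ℝ, ℂ)) : Integrable (𝓕⁻ (k : ℝ → ℂ)) := by
  rw [← SchwartzMap.fourierInv_coe]
  exact (𝓕⁻ k).integrable

lemma integrable_norm_mul_abs_fourierInv (k : 𝓢(ℝ, ℂ)) :
    Integrable fun u => ‖𝓕⁻ (k : ℝ → ℂ) u‖ * |u| := by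
  rw [← SchwartzMap.fourierInv_coe]
  refine ((𝓕⁻ k).integrable_pow_mul volume 1).congr (Eventually.of_forall fun u => ?_)
  simp only [pow_one, Real.norm_eq_abs, mul_comm]

lemma fourierInv_comp_div (k : ℝ → ℂ) {r : ℝ} (hr : 0 < r) (u : ℝ) :
    𝓕⁻ (fun ξ => k (ξ / r)) u = r * 𝓕⁻ k (r * u) := by
  rw [Real.fourierInv_eq, Real.fourierInv_eq]
  have h := Measure.integral_comp_div
    (fun v : ℝ => Real.fourierChar (inner ℝ v (r * u)) • k v) r
  rw [abs_of_pos hr] at h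
  rw [← Complex.real_smul, ← h]
  refine integral_congr_ae (Eventually.of_forall fun v => ?_)
  simp only [RCLike.inner_apply, conj_trivial]
  congr 2
  field_simp

/-- Smoothing a Lipschitz function at scale `1 / r`. -/
lemma norm_sub_integral_fourierInv_comp_div_le {k : 𝓢(ℝ, ℂ)} (hk0 : k 0 = 1) {r : ℝ} (hr : 0 < r)
    {kr : 𝓢(ℝ, ℂ)} (hkr : ∀ ξ, kr ξ = k (ξ / r)) {G : ℝ → ℝ} (hGm : Measurable G) {L M : ℝ}
    (hGM : ∀ t, |G t| ≤ M) (hGL : ∀ t u, |G t - G u| ≤ L * |t - u|) (t : ℝ) :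
    ‖(G t : ℂ) - ∫ u, 𝓕⁻ (kr : ℝ → ℂ) (t - u) * G u‖ ≤
      L * (∫ u, ‖𝓕⁻ (k : ℝ → ℂ) u‖ * |u|) / r := by
  set K := 𝓕⁻ (kr : ℝ → ℂ) with hK
  have hKi : Integrable K := integrable_fourierInv kr
  have hK1 : ∫ u, K u = 1 := by
    rw [hK, integral_fourierInv, hkr, zero_div, hk0]
  have hKs : ∀ u, K u = r * 𝓕⁻ (k : ℝ → ℂ) (r * u) := fun u => by
    rw [hK, funext hkr]
    exact fourierInv_comp_div _ hr u
  have hKG : Integrable fun u => K u * (G (t - u) : ℂ) := by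
    refine hKi.mul_bdd (c := M) (Complex.measurable_ofReal.comp
      (hGm.comp (measurable_const.sub measurable_id))).aestronglyMeasurable
      (Eventually.of_forall fun u => ?_)
    simpa using hGM _
  have h1 : (G t : ℂ) - ∫ u, K (t - u) * G u = ∫ u, K u * ((G t - G (t - u) : ℝ) : ℂ) := by
    rw [← integral_sub_left_eq_self _ volume t]
    simp only [sub_sub_cancel, Complex.ofReal_sub, mul_sub]
    rw [integral_sub (hKi.mul_const _) hKG, integral_mul_const, hK1, one_mul]
  have hint := integrable_norm_mul_abs_fourierInv k
  have h2 : L * (∫ u, ‖𝓕⁻ (k : ℝ → ℂ) u‖ * |u|) / r =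
      ∫ u, L * (‖𝓕⁻ (k : ℝ → ℂ) (r * u)‖ * |r * u|) := by
    rw [integral_const_mul, Measure.integral_comp_mul_left
      (fun u => ‖𝓕⁻ (k : ℝ → ℂ) u‖ * |u|) r, abs_of_pos (inv_pos.2 hr), smul_eq_mul]
    field_simp
  rw [h1, h2]
  refine norm_integral_le_of_norm_le ((hint.comp_mul_left' hr.ne').const_mul L)
    (Eventually.of_forall fun u => ?_)
  have h3 := hGL t (t - u)
  rw [sub_sub_cancel] at h3
  rw [norm_mul, Complex.norm_real, Real.norm_eq_abs, hKs, norm_mul, Complex.norm_real,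
    Real.norm_of_nonneg hr.le, abs_mul, abs_of_pos hr]
  calc r * ‖𝓕⁻ (k : ℝ → ℂ) (r * u)‖ * |G t - G (t - u)|
      ≤ r * ‖𝓕⁻ (k : ℝ → ℂ) (r * u)‖ * (L * |u|) := by gcongr
    _ = _ := by ring

lemma tendsto_integral_sub_mul {K : ℝ → ℂ} (hK : Integrable K) {e : ℝ → ℝ} (hem : Measurable e)
    {M c : ℝ} (heM : ∀ t, |e t| ≤ M) (hec : Tendsto e atTop (𝓝 c)) :
    Tendsto (fun t => ∫ u, K (t - u) * e u) atTop (𝓝 ((∫ u, K u) * c)) := by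
  have h : ∀ t, ∫ u, K (t - u) * (e u : ℂ) = ∫ u, K u * (e (t - u) : ℂ) := fun t => by
    rw [← integral_sub_left_eq_self _ volume t]
    simp only [sub_sub_cancel]
  simp only [h]
  rw [← integral_mul_const]
  refine tendsto_integral_filter_of_dominated_convergence (fun u => ‖K u‖ * M)
    (Eventually.of_forall fun t => hK.aestronglyMeasurable.mul (Complex.measurable_ofReal.comp
      (hem.comp (measurable_const.sub measurable_id))).aestronglyMeasurable)
    (Eventually.of_forall fun t => Eventually.of_forall fun u => ?_) (hK.norm.mul_const M)
    (Eventually.of_forall fun u => ?_)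
  · rw [norm_mul, Complex.norm_real, Real.norm_eq_abs]
    exact mul_le_mul_of_nonneg_left (heM _) (norm_nonneg _)
  · refine Tendsto.const_mul _ ((Complex.continuous_ofReal.tendsto c).comp (hec.comp ?_))
    exact tendsto_atTop_add_const_right _ (-u) tendsto_id

/-- A Tauberian theorem of Wiener type for superpositions of translates: if the Fourier
transform of `ρ` is a smooth multiple `m` of that of `φ`, then convergence of a superposition of
translates of `φ` forces convergence of the same superposition of translates of `ρ`. -/
theorem tendsto_superposition_of_fourier_eq_mul {φ ρ : ℝ → ℝ} (hφ0 : ∀ t, 0 ≤ φ t)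
    (hφm : Measurable φ) (hφi : Integrable fun t => (φ t : ℂ)) (hρ0 : ∀ t, 0 ≤ ρ t)
    (hρm : Measurable ρ) (hρi : Integrable fun t => (ρ t : ℂ)) {m : ℝ → ℂ}
    (hm : ContDiff ℝ ∞ m)
    (hmul : ∀ ξ, 𝓕 (fun t => (ρ t : ℂ)) ξ = m ξ * 𝓕 (fun t => (φ t : ℂ)) ξ)
    {w b : ℕ → ℝ} (hw : ∀ j, 0 ≤ w j) {e G : ℝ → ℝ}
    (he : ∀ t, HasSum (fun j => w j * φ (t - b j)) (e t))
    (hG : ∀ t, HasSum (fun j => w j * ρ (t - b j)) (G t)) {M L c : ℝ} (heM : ∀ t, |e t| ≤ M)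
    (hGM : ∀ t, |G t| ≤ M) (hGL : ∀ t u, |G t - G u| ≤ L * |t - u|)
    (hec : Tendsto e atTop (𝓝 c)) :
    Tendsto (fun t => (G t : ℂ)) atTop (𝓝 (m 0 * c)) := by
  have hem := measurable_of_hasSum_translates hφm he
  have hGm := measurable_of_hasSum_translates hρm hG
  let k₀ : ContDiffBump (0 : ℝ) := ⟨1, 2, one_pos, one_lt_two⟩
  have hk₀c : HasCompactSupport fun ξ => (k₀ ξ : ℂ) :=
    k₀.hasCompactSupport.comp_left Complex.ofReal_zero
  have hk₀s : ContDiff ℝ ∞ fun ξ => (k₀ ξ : ℂ) := Complex.ofRealCLM.contDiff.comp k₀.contDiff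
  let k : 𝓢(ℝ, ℂ) := hk₀c.toSchwartzMap hk₀s
  have hk0 : k 0 = 1 := by
    change ((k₀ 0 : ℝ) : ℂ) = 1
    rw [k₀.one_of_mem_closedBall (Metric.mem_closedBall_self zero_le_one), Complex.ofReal_one]
  set B := L * ∫ u, ‖𝓕⁻ (k : ℝ → ℂ) u‖ * |u| with hB
  rw [Metric.tendsto_atTop']
  intro ε hε
  obtain ⟨r, hr1, hrB⟩ : ∃ r : ℝ, 0 < r ∧ B / r < ε / 2 := by
    refine ⟨(|B| + 1) * (2 / ε), by positivity, ?_⟩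
    rw [div_lt_iff₀ (by positivity)]
    have : ε / 2 * ((|B| + 1) * (2 / ε)) = |B| + 1 := by field_simp
    linarith [le_abs_self B]
  have hkrc : HasCompactSupport fun ξ => (k₀ (ξ / r) : ℂ) := by
    have := hk₀c.comp_homeomorph (Homeomorph.mulRight₀ r⁻¹ (inv_ne_zero hr1.ne'))
    simpa [Function.comp_def, div_eq_mul_inv] using this
  have hkrs : ContDiff ℝ ∞ fun ξ => (k₀ (ξ / r) : ℂ) := hk₀s.comp (contDiff_id.div_const r)
  let kr : 𝓢(ℝ, ℂ) := hkrc.toSchwartzMap hkrs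
  let kr1 : 𝓢(ℝ, ℂ) := (hkrc.mul_right (f' := m)).toSchwartzMap (hkrs.mul hm)
  have hkr : ∀ ξ, kr ξ = k (ξ / r) := fun ξ => rfl
  have hkr1 : ∀ ξ, kr1 ξ = kr ξ * m ξ := fun ξ => rfl
  have hconv : ∀ t, ∫ u, 𝓕⁻ (kr : ℝ → ℂ) (t - u) * (ρ u : ℂ) =
      ∫ u, 𝓕⁻ (kr1 : ℝ → ℂ) (t - u) * (φ u : ℂ) := fun t => by
    rw [integral_fourierInv_sub_mul kr.integrable hρi,
      integral_fourierInv_sub_mul kr1.integrable hφi]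
    simp only [hmul, hkr1, mul_assoc]
  have heq : ∀ t, ∫ u, 𝓕⁻ (kr : ℝ → ℂ) (t - u) * (G u : ℂ) =
      ∫ u, 𝓕⁻ (kr1 : ℝ → ℂ) (t - u) * (e u : ℂ) := fun t => by
    have h1 := hasSum_integral_mul_of_hasSum_translates (integrable_fourierInv kr)
      hρ0 hρm hw hG (fun t => (le_abs_self _).trans (hGM t)) t
    have h2 := hasSum_integral_mul_of_hasSum_translates (integrable_fourierInv kr1)
      hφ0 hφm hw he (fun t => (le_abs_self _).trans (heM t)) t
    simp only [hconv] at h1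
    exact h1.unique h2
  have hlim := tendsto_integral_sub_mul (integrable_fourierInv kr1) hem heM hec
  have hval : (∫ u, 𝓕⁻ (kr1 : ℝ → ℂ) u) = m 0 := by
    rw [integral_fourierInv, hkr1, hkr, zero_div, hk0, one_mul]
  rw [hval] at hlim
  obtain ⟨T, hT⟩ := (Metric.tendsto_atTop'.1 hlim) (ε / 2) (half_pos hε)
  refine ⟨T, fun t ht => ?_⟩
  have h1 := norm_sub_integral_fourierInv_comp_div_le hk0 hr1 hkr hGm hGM hGL t
  rw [heq, ← dist_eq_norm] at h1
  have h2 := hT t ht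
  calc dist (G t : ℂ) (m 0 * c) ≤ _ := dist_triangle _ _ _
    _ < ε / 2 + ε / 2 := add_lt_add (h1.trans_lt hrB) h2
    _ = ε := add_halves ε

end Wiener

/-! ### The Fourier transforms of the fractional part and truncation kernels -/

section Kernels

open scoped FourierTransform ContDiff

lemma integrable_exp_mul_comp_exp {D : ℝ} {f : ℝ → ℝ}
    (hf : IntegrableOn (fun x : ℝ => (f x : ℂ) * (x : ℂ) ^ (-((D : ℂ) + 1))) (Set.Ioi 0)) :
    Integrable fun t : ℝ => ((Real.exp (-D * t) * f (Real.exp t) : ℝ) : ℂ) := by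
  have himg : Real.exp '' Set.univ = Set.Ioi 0 := by rw [Set.image_univ, Real.range_exp]
  rw [← himg, integrableOn_image_iff_integrableOn_abs_deriv_smul MeasurableSet.univ
    (fun x _ => (Real.hasDerivAt_exp x).hasDerivWithinAt) Real.exp_injective.injOn,
    integrableOn_univ] at hf
  refine hf.congr (Eventually.of_forall fun t => ?_)
  simp only [abs_of_pos (Real.exp_pos t), Complex.real_smul]
  rw [Complex.cpow_def_of_ne_zero (by exact_mod_cast (Real.exp_pos t).ne'),
    ← Complex.ofReal_log (Real.exp_pos t).le, Real.log_exp]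
  push_cast
  have : Complex.exp (-D * t) = Complex.exp t * Complex.exp (t * -((D : ℂ) + 1)) := by
    rw [← Complex.exp_add]
    congr 1
    ring
  rw [this]
  ring

lemma fourier_exp_mul_comp_exp (D : ℝ) (f : ℝ → ℝ) (ξ : ℝ) :
    𝓕 (fun t : ℝ => ((Real.exp (-D * t) * f (Real.exp t) : ℝ) : ℂ)) ξ =
      ∫ x in Set.Ioi (0 : ℝ),
        (f x : ℂ) * (x : ℂ) ^ (-(((D : ℂ) + 2 * Real.pi * ξ * Complex.I) + 1)) := by
  have himg : Real.exp '' Set.univ = Set.Ioi 0 := by rw [Set.image_univ, Real.range_exp]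
  rw [← himg, integral_image_eq_integral_abs_deriv_smul MeasurableSet.univ
    (fun x _ => (Real.hasDerivAt_exp x).hasDerivWithinAt) Real.exp_injective.injOn,
    Measure.restrict_univ, Real.fourier_real_eq_integral_exp_smul]
  refine integral_congr_ae (Eventually.of_forall fun t => ?_)
  simp only [abs_of_pos (Real.exp_pos t), Complex.real_smul, smul_eq_mul]
  rw [Complex.cpow_def_of_ne_zero (by exact_mod_cast (Real.exp_pos t).ne'),
    ← Complex.ofReal_log (Real.exp_pos t).le, Real.log_exp]
  push_cast
  have : Complex.exp (-2 * Real.pi * t * ξ * Complex.I) * Complex.exp (-D * t) =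
      Complex.exp t * Complex.exp (t * -(((D : ℂ) + 2 * Real.pi * ξ * Complex.I) + 1)) := by
    rw [← Complex.exp_add, ← Complex.exp_add]
    congr 1
    ring
  rw [← mul_assoc, this]
  ring

lemma min_mul_cpow_aux {s : ℂ} (hs : 0 < s.re) (hs1 : s.re < 1) :
    IntegrableOn (fun x : ℝ => ((min x 1 : ℝ) : ℂ) * (x : ℂ) ^ (-(s + 1))) (Set.Ioi 0) ∧
      ∫ x in Set.Ioi (0 : ℝ), ((min x 1 : ℝ) : ℂ) * (x : ℂ) ^ (-(s + 1)) =
        1 / (s * (1 - s)) := by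
  have hs0 : s ≠ 0 := fun h => by simp [h] at hs
  have h1s : 1 - s ≠ 0 := fun h => by
    rw [← sub_eq_zero.1 h] at hs1
    simp at hs1
  have heq1 : Set.EqOn (fun x : ℝ => (x : ℂ) ^ (-s))
      (fun x : ℝ => ((min x 1 : ℝ) : ℂ) * (x : ℂ) ^ (-(s + 1))) (Set.Ioc 0 1) := by
    intro x hx
    have hx0 : (x : ℂ) ≠ 0 := by exact_mod_cast hx.1.ne'
    simp only [min_eq_left hx.2]
    have : -s = 1 + -(s + 1) := by ring
    rw [this, Complex.cpow_add _ _ hx0, Complex.cpow_one]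
  have heq2 : Set.EqOn (fun x : ℝ => (x : ℂ) ^ (-(s + 1)))
      (fun x : ℝ => ((min x 1 : ℝ) : ℂ) * (x : ℂ) ^ (-(s + 1))) (Set.Ioi 1) := by
    intro x hx
    simp [min_eq_right (le_of_lt (show 1 < x from hx))]
  have hre : (-(s + 1)).re < -1 := by simpa using hs
  have hi1 := (FractalString.integrableOn_cpow_neg hs1 one_pos).congr_fun heq1 measurableSet_Ioc
  have hi2 := (integrableOn_Ioi_cpow_of_lt hre one_pos).congr_fun heq2 measurableSet_Ioi
  rw [← Set.Ioc_union_Ioi_eq_Ioi zero_le_one]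
  refine ⟨hi1.union hi2, ?_⟩
  rw [setIntegral_union (Set.Ioc_disjoint_Ioi le_rfl) measurableSet_Ioi hi1 hi2,
    ← setIntegral_congr_fun measurableSet_Ioc heq1, ← setIntegral_congr_fun measurableSet_Ioi heq2,
    FractalString.integral_cpow_neg hs1 one_pos, integral_Ioi_cpow_of_lt hre one_pos]
  have : -(s + 1) + 1 = -s := by ring
  rw [this, Complex.ofReal_one, Complex.one_cpow, Complex.one_cpow]
  field_simp
  ring

lemma contDiff_kernel_ratio {D : ℝ} (hD : D < 1)
    (hζ : ∀ s : ℂ, s.re = D → riemannZeta s ≠ 0) :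
    ContDiff ℝ ∞ fun ξ : ℝ => -1 / (riemannZeta ((D : ℂ) + 2 * Real.pi * ξ * Complex.I) *
      (1 - ((D : ℂ) + 2 * Real.pi * ξ * Complex.I))) := by
  have hre : ∀ ξ : ℝ, ((D : ℂ) + 2 * Real.pi * ξ * Complex.I).re = D := fun ξ => by simp
  have hne : ∀ ξ : ℝ, ((D : ℂ) + 2 * Real.pi * ξ * Complex.I) ≠ 1 := fun ξ h => by
    have := hre ξ
    rw [h, Complex.one_re] at this
    linarith
  have haff : ContDiff ℝ ∞ fun ξ : ℝ => (D : ℂ) + 2 * Real.pi * ξ * Complex.I :=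
    contDiff_const.add ((contDiff_const.mul Complex.ofRealCLM.contDiff).mul contDiff_const)
  have hzeta : ContDiffOn ℂ ∞ riemannZeta {1}ᶜ :=
    (DifferentiableOn.contDiffOn (fun s hs =>
      (differentiableAt_riemannZeta hs).differentiableWithinAt) isOpen_compl_singleton)
  have hcomp : ContDiff ℝ ∞ fun ξ : ℝ =>
      riemannZeta ((D : ℂ) + 2 * Real.pi * ξ * Complex.I) :=
    (hzeta.restrict_scalars ℝ).comp_contDiff haff fun ξ => hne ξ
  simp only [div_eq_mul_inv]
  refine contDiff_const.mul ((hcomp.mul (contDiff_const.sub haff)).inv fun ξ => ?_)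
  exact mul_ne_zero (hζ _ (hre ξ)) (sub_ne_zero.2 (hne ξ).symm)

end Kernels

namespace FractalString

/-! ### Minkowski measurability from the spectral asymptotics -/

section Tube

variable (S : FractalString)

lemma summable_min_mul {x : ℝ} (hx : 0 ≤ x) : Summable fun j => min (S.l j * x) 1 :=
  Summable.of_nonneg_of_le (fun j => le_min (mul_nonneg (S.l_pos j).le hx) zero_le_one)
    (fun _ => min_le_left _ _) (S.summable_l.mul_right x)

lemma tsum_min_mul_le {x : ℝ} (hx : 0 ≤ x) :
    ∑' j, min (S.l j * x) 1 ≤ (∑' j, S.l j) * x := by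
  rw [← tsum_mul_right]
  exact (S.summable_min_mul hx).tsum_le_tsum (fun _ => min_le_left _ _) (S.summable_l.mul_right x)

lemma tsum_fract_le {x : ℝ} (hx : 0 < x) :
    ∑' j, Int.fract (S.l j * x) ≤ (∑' j, S.l j) * x := by
  rw [← tsum_mul_right]
  refine (S.weyl_sub_Nnu hx).1.tsum_le_tsum (fun j => ?_) (S.summable_l.mul_right x)
  have : (0 : ℝ) ≤ ⌊S.l j * x⌋ := by
    exact_mod_cast Int.floor_nonneg.2 (mul_pos (S.l_pos j) hx).le
  linarith [Int.self_sub_floor (S.l j * x)]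

lemma min_two_mul_le (u : ℝ) (hu : 0 ≤ u) : min (2 * u) 1 ≤ min u 1 + Int.fract u := by
  rcases lt_or_ge u 1 with h | h
  · rw [min_eq_left h.le, Int.fract_eq_self.2 ⟨hu, h⟩]
    linarith [min_le_left (2 * u) 1]
  · rw [min_eq_right h]
    linarith [min_le_right (2 * u) 1, Int.fract_nonneg u]

lemma tsum_min_two_mul_le {x : ℝ} (hx : 0 < x) :
    ∑' j, min (S.l j * (2 * x)) 1 ≤
      ∑' j, min (S.l j * x) 1 + ∑' j, Int.fract (S.l j * x) := by
  rw [← (S.summable_min_mul hx.le).tsum_add (S.weyl_sub_Nnu hx).1]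
  refine (S.summable_min_mul (by positivity)).tsum_le_tsum (fun j => ?_)
    ((S.summable_min_mul hx.le).add (S.weyl_sub_Nnu hx).1)
  have := min_two_mul_le (S.l j * x) (mul_pos (S.l_pos j) hx).le
  rwa [show S.l j * (2 * x) = 2 * (S.l j * x) by ring]

/-- A power bound for the sum of fractional parts passes to the sum of truncations. -/
lemma tsum_min_mul_le_rpow {D C : ℝ} (hD : 0 < D)
    (hC : ∀ x : ℝ, 0 < x → ∑' j, Int.fract (S.l j * x) ≤ C * x ^ D) {x : ℝ} (hx : 0 < x) :
    ∑' j, min (S.l j * x) 1 ≤ C / (2 ^ D - 1) * x ^ D := by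
  have h2D : 0 < (2 : ℝ) ^ D - 1 := sub_pos.2 (Real.one_lt_rpow one_lt_two hD)
  have hind : ∀ n : ℕ, ∀ x : ℝ, 0 < x → ∑' j, min (S.l j * x) 1 ≤
      (∑' j, S.l j) * x * (1 / 2) ^ n + C / (2 ^ D - 1) * x ^ D := by
    intro n
    have hC0 : 0 ≤ C := by
      have := hC 1 one_pos
      rw [Real.one_rpow, mul_one] at this
      exact (tsum_nonneg fun j => Int.fract_nonneg _).trans this
    induction n with
    | zero =>
      intro x hx
      have := S.tsum_min_mul_le hx.le
      have : 0 ≤ C / (2 ^ D - 1) * x ^ D := by positivity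
      linarith
    | succ n ih =>
      intro x hx
      have h1 := S.tsum_min_two_mul_le (half_pos hx)
      rw [mul_div_cancel₀ x two_ne_zero] at h1
      have h2 := ih _ (half_pos hx)
      have h3 := hC _ (half_pos hx)
      have h4 : C / (2 ^ D - 1) * (x / 2) ^ D + C * (x / 2) ^ D = C / (2 ^ D - 1) * x ^ D := by
        rw [Real.div_rpow hx.le zero_le_two]
        have : (2 : ℝ) ^ D ≠ 0 := (Real.rpow_pos_of_pos zero_lt_two D).ne'
        field_simp
        ring
      rw [pow_succ]
      linarith
  have hlim : Tendsto (fun n : ℕ => (∑' j, S.l j) * x * (1 / 2) ^ n + C / (2 ^ D - 1) * x ^ D)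
      atTop (𝓝 ((∑' j, S.l j) * x * 0 + C / (2 ^ D - 1) * x ^ D)) :=
    ((tendsto_pow_atTop_nhds_zero_of_lt_one (by norm_num) (by norm_num)).const_mul _).add_const _
  rw [mul_zero, zero_add] at hlim
  exact ge_of_tendsto' hlim fun n => hind n x hx

lemma exists_tsum_fract_le_rpow {D c : ℝ} (hD1 : D < 1)
    (h : Tendsto (fun x : ℝ => (∑' j, Int.fract (S.l j * x)) / x ^ D) atTop (𝓝 c)) :
    ∃ C, ∀ x : ℝ, 0 < x → ∑' j, Int.fract (S.l j * x) ≤ C * x ^ D := by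
  obtain ⟨X, hX⟩ := (h.eventually_le_const (lt_add_one c)).exists_forall_of_atTop
  have hA : 0 ≤ ∑' j, S.l j := tsum_nonneg fun j => (S.l_pos j).le
  refine ⟨max (c + 1) ((∑' j, S.l j) * (max X 1) ^ (1 - D)), fun x hx => ?_⟩
  have hxD := Real.rpow_pos_of_pos hx D
  rcases le_total X x with hXx | hXx
  · exact ((div_le_iff₀ hxD).1 (hX x hXx)).trans
      (mul_le_mul_of_nonneg_right (le_max_left _ _) hxD.le)
  · refine (S.tsum_fract_le hx).trans
      (le_trans ?_ (mul_le_mul_of_nonneg_right (le_max_right _ _) hxD.le))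
    rw [mul_assoc]
    refine mul_le_mul_of_nonneg_left ?_ hA
    calc x = x ^ (1 - D) * x ^ D := by
          rw [← Real.rpow_add hx, sub_add_cancel, Real.rpow_one]
      _ ≤ (max X 1) ^ (1 - D) * x ^ D := by
          gcongr
          exact hXx.trans (le_max_left _ _)

lemma tsum_min_mul_mono {x y : ℝ} (hx : 0 ≤ x) (hxy : x ≤ y) :
    ∑' j, min (S.l j * x) 1 ≤ ∑' j, min (S.l j * y) 1 :=
  (S.summable_min_mul hx).tsum_le_tsum
    (fun j => min_le_min_right _ (mul_le_mul_of_nonneg_left hxy (S.l_pos j).le))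
    (S.summable_min_mul (hx.trans hxy))

lemma tsum_min_mul_mul_le {x r : ℝ} (hx : 0 ≤ x) (hr : 1 ≤ r) :
    ∑' j, min (S.l j * (r * x)) 1 ≤ r * ∑' j, min (S.l j * x) 1 := by
  rw [← tsum_mul_left]
  refine (S.summable_min_mul (by positivity)).tsum_le_tsum (fun j => ?_)
    ((S.summable_min_mul hx).mul_left r)
  rw [mul_min_of_nonneg _ _ (by positivity : 0 ≤ r)]
  refine min_le_min (le_of_eq (by ring)) (by linarith)

/-- The tube function in logarithmic scale is Lipschitz. -/
lemma abs_exp_mul_tsum_min_sub_le {D M : ℝ} (hD : D ∈ Set.Ioo (0 : ℝ) 1)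
    (hM : ∀ t, Real.exp (-D * t) * ∑' j, min (S.l j * Real.exp t) 1 ≤ M) (t u : ℝ) :
    |Real.exp (-D * t) * ∑' j, min (S.l j * Real.exp t) 1 -
      Real.exp (-D * u) * ∑' j, min (S.l j * Real.exp u) 1| ≤ M * |t - u| := by
  wlog htu : t ≤ u generalizing t u
  · rw [abs_sub_comm, abs_sub_comm t]
    exact this u t (le_of_not_ge htu)
  set G : ℝ → ℝ := fun t => Real.exp (-D * t) * ∑' j, min (S.l j * Real.exp t) 1 with hG
  change |G t - G u| ≤ _
  have hG0 : ∀ t, 0 ≤ G t := fun t => mul_nonneg (Real.exp_pos _).le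
    (tsum_nonneg fun j => le_min (mul_pos (S.l_pos j) (Real.exp_pos t)).le zero_le_one)
  have h1 : Real.exp (-D * (u - t)) * G t ≤ G u := by
    have := S.tsum_min_mul_mono (Real.exp_pos t).le (Real.exp_le_exp.2 htu)
    simp only [hG]
    rw [← mul_assoc, ← Real.exp_add]
    have h2 : -D * (u - t) + -D * t = -D * u := by ring
    rw [h2]
    exact mul_le_mul_of_nonneg_left this (Real.exp_pos _).le
  have h2 : Real.exp (-(1 - D) * (u - t)) * G u ≤ G t := by
    have := S.tsum_min_mul_mul_le (Real.exp_pos t).le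
      (Real.one_le_exp (sub_nonneg.2 htu))
    rw [← Real.exp_add, sub_add_cancel] at this
    simp only [hG]
    have h3 := mul_le_mul_of_nonneg_left this
      (Real.exp_pos (-(1 - D) * (u - t) + -D * u)).le
    rw [← mul_assoc, ← Real.exp_add] at h3
    rw [← mul_assoc, ← Real.exp_add]
    refine h3.trans (le_of_eq ?_)
    congr 2
    ring
  have hut : 0 ≤ u - t := sub_nonneg.2 htu
  rw [abs_sub_comm t, abs_of_nonneg hut, abs_le]
  have h3 := Real.add_one_le_exp (-D * (u - t))
  have h4 := Real.add_one_le_exp (-(1 - D) * (u - t))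
  have h5 := mul_le_mul_of_nonneg_right h3 (hG0 t)
  have h6 := mul_le_mul_of_nonneg_right h4 (hG0 u)
  have hGt := hM t
  have hGu := hM u
  have h7 : D * (u - t) * G t ≤ (u - t) * M := by
    refine mul_le_mul ?_ hGt (hG0 t) hut
    exact mul_le_of_le_one_left hut hD.2.le
  have h8 : (1 - D) * (u - t) * G u ≤ (u - t) * M := by
    refine mul_le_mul ?_ hGu (hG0 u) hut
    exact mul_le_of_le_one_left hut (by linarith [hD.1])
  constructor <;> nlinarith

lemma hasSum_exp_mul_translates {D : ℝ} {f : ℝ → ℝ} {t : ℝ}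
    (hf : Summable fun j => f (S.l j * Real.exp t)) :
    HasSum (fun j => S.l j ^ D * (Real.exp (-D * (t - -Real.log (S.l j))) *
      f (Real.exp (t - -Real.log (S.l j)))))
      (Real.exp (-D * t) * ∑' j, f (S.l j * Real.exp t)) := by
  refine Eq.mp (congrArg (HasSum · _) (funext fun j => ?_)) (hf.hasSum.mul_left _)
  have hl := S.l_pos j
  rw [sub_neg_eq_add, Real.exp_add, Real.exp_log hl, mul_comm (Real.exp t), ← mul_assoc,
    Real.rpow_def_of_pos hl, ← Real.exp_add]
  congr 2
  ring

/-- If zeta has no zeros on the line `Re s = D`, then a monomial second term in the spectral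
asymptotics forces Minkowski measurability. -/
theorem minkowskiMeasurable_of_tendsto {D c : ℝ} (hD : D ∈ Set.Ioo (0 : ℝ) 1) (hc : 0 < c)
    (hζ : ∀ s : ℂ, s.re = D → riemannZeta s ≠ 0)
    (h : Tendsto (fun x : ℝ => (∑' j, Int.fract (S.l j * x)) / x ^ D) atTop (𝓝 c)) :
    S.MinkowskiMeasurable D := by
  obtain ⟨r, hr0, hr⟩ := exists_riemannZeta_eq_neg hD
  obtain ⟨C, hC⟩ := S.exists_tsum_fract_le_rpow hD.2 h
  have hexpD : ∀ t, Real.exp (-D * t) * Real.exp t ^ D = 1 := fun t => by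
    rw [← Real.exp_mul, ← Real.exp_add, ← Real.exp_zero]
    congr 1
    ring
  have hscale : ∀ {a C t : ℝ}, a ≤ C * Real.exp t ^ D → Real.exp (-D * t) * a ≤ C := by
    intro a C t ha
    calc Real.exp (-D * t) * a ≤ Real.exp (-D * t) * (C * Real.exp t ^ D) :=
          mul_le_mul_of_nonneg_left ha (Real.exp_pos _).le
      _ = C := by rw [mul_left_comm, hexpD, mul_one]
  set φ : ℝ → ℝ := fun t => Real.exp (-D * t) * Int.fract (Real.exp t) with hφ
  set ρ : ℝ → ℝ := fun t => Real.exp (-D * t) * min (Real.exp t) 1 with hρ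
  set e : ℝ → ℝ := fun t => Real.exp (-D * t) * ∑' j, Int.fract (S.l j * Real.exp t) with he
  set G : ℝ → ℝ := fun t => Real.exp (-D * t) * ∑' j, min (S.l j * Real.exp t) 1 with hG
  have heb : ∀ t, e t ≤ C := fun t => hscale (hC _ (Real.exp_pos t))
  have hGb : ∀ t, G t ≤ C / (2 ^ D - 1) := fun t =>
    hscale (S.tsum_min_mul_le_rpow hD.1 hC (Real.exp_pos t))
  have he0 : ∀ t, 0 ≤ e t := fun t =>
    mul_nonneg (Real.exp_pos _).le (tsum_nonneg fun j => Int.fract_nonneg _)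
  have hG0 : ∀ t, 0 ≤ G t := fun t => mul_nonneg (Real.exp_pos _).le
    (tsum_nonneg fun j => le_min (mul_pos (S.l_pos j) (Real.exp_pos t)).le zero_le_one)
  have hec : Tendsto e atTop (𝓝 c) := by
    refine (h.comp Real.tendsto_exp_atTop).congr fun t => ?_
    simp only [Function.comp_apply, he]
    rw [div_eq_iff (Real.rpow_pos_of_pos (Real.exp_pos t) D).ne', mul_right_comm, hexpD, one_mul]
  have hre : ∀ ξ : ℝ, ((D : ℂ) + 2 * Real.pi * ξ * Complex.I).re = D := fun ξ => by simp
  have hDre : (D : ℂ).re ∈ Set.Ioo (0 : ℝ) 1 := by simpa using hD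
  have key := tendsto_superposition_of_fourier_eq_mul (φ := φ) (ρ := ρ)
    (w := fun j => S.l j ^ D) (b := fun j => -Real.log (S.l j)) (e := e) (G := G)
    (M := max C (C / (2 ^ D - 1))) (L := C / (2 ^ D - 1)) (c := c)
    (fun t => mul_nonneg (Real.exp_pos _).le (Int.fract_nonneg _))
    (by fun_prop)
    (integrable_exp_mul_comp_exp (f := Int.fract) (integrableOn_fract_mul_cpow hDre.1 hDre.2))
    (fun t => mul_nonneg (Real.exp_pos _).le (le_min (Real.exp_pos t).le zero_le_one))
    (by fun_prop)
    (integrable_exp_mul_comp_exp (f := fun x => min x 1) (min_mul_cpow_aux hDre.1 hDre.2).1)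
    (contDiff_kernel_ratio hD.2 hζ)
    (fun ξ => by
      have hs : 0 < ((D : ℂ) + 2 * Real.pi * ξ * Complex.I).re := by rw [hre]; exact hD.1
      have hs1 : ((D : ℂ) + 2 * Real.pi * ξ * Complex.I).re < 1 := by rw [hre]; exact hD.2
      have h1 := fourier_exp_mul_comp_exp D (fun x => min x 1) ξ
      have h2 := fourier_exp_mul_comp_exp D Int.fract ξ
      have h3 := hζ _ (hre ξ)
      rw [(min_mul_cpow_aux hs hs1).2] at h1
      rw [integral_fract_mul_cpow hs hs1] at h2
      rw [h1, h2]
      generalize (D : ℂ) + 2 * Real.pi * ξ * Complex.I = s at *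
      have hs0 : s ≠ 0 := fun h => by simp [h] at hs
      have h1s : 1 - s ≠ 0 := fun h => by
        rw [← sub_eq_zero.1 h] at hs1
        simp at hs1
      field_simp)
    (fun j => (Real.rpow_pos_of_pos (S.l_pos j) D).le)
    (fun t => S.hasSum_exp_mul_translates (f := Int.fract) (S.weyl_sub_Nnu (Real.exp_pos t)).1)
    (fun t => S.hasSum_exp_mul_translates (f := fun x => min x 1)
      (S.summable_min_mul (Real.exp_pos t).le))
    (fun t => by rw [abs_of_nonneg (he0 t)]; exact (heb t).trans (le_max_left _ _))
    (fun t => by rw [abs_of_nonneg (hG0 t)]; exact (hGb t).trans (le_max_right _ _))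
    (S.abs_exp_mul_tsum_min_sub_le hD hGb) hec
  have hlim : Tendsto G atTop (𝓝 (c / (r * (1 - D)))) := by
    have := (Complex.continuous_re.tendsto _).comp key
    refine (this.congr fun t => Complex.ofReal_re _).trans_eq ?_
    congr 1
    have h1 : -1 / (riemannZeta ((D : ℂ) + 2 * Real.pi * ((0 : ℝ) : ℂ) * Complex.I) *
        (1 - ((D : ℂ) + 2 * Real.pi * ((0 : ℝ) : ℂ) * Complex.I))) * (c : ℂ) =
        ((c / (r * (1 - D)) : ℝ) : ℂ) := by
      rw [Complex.ofReal_zero, mul_zero, zero_mul, add_zero, hr]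
      push_cast
      rw [neg_mul, neg_div_neg_eq]
      ring
    rw [h1, Complex.ofReal_re]
  have hD1 : 0 < 1 - D := sub_pos.2 hD.2
  refine ⟨c / (r * (1 - D)) * 2 ^ (1 - D), by positivity, ?_⟩
  have hη : Tendsto (fun ε : ℝ => -Real.log (2 * ε)) (𝓝[>] 0) atTop := by
    refine tendsto_neg_atBot_atTop.comp (Real.tendsto_log_nhdsGT_zero.comp ?_)
    refine tendsto_nhdsWithin_iff.2 ⟨?_, ?_⟩
    · have : Tendsto (fun ε : ℝ => 2 * ε) (𝓝 0) (𝓝 (2 * 0)) := tendsto_id.const_mul 2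
      rw [mul_zero] at this
      exact this.mono_left nhdsWithin_le_nhds
    · filter_upwards [self_mem_nhdsWithin] with ε hε
      exact mul_pos two_pos (show (0 : ℝ) < ε from hε)
  refine ((hlim.comp hη).mul_const (2 ^ (1 - D))).congr' ?_
  filter_upwards [self_mem_nhdsWithin] with ε hε
  have hε0 : 0 < ε := hε
  have h2ε : 0 < 2 * ε := by positivity
  simp only [Function.comp_apply, hG]
  rw [S.volume_innerNbhd hε0, Real.exp_neg, Real.exp_log h2ε, neg_mul_neg, mul_comm D,
    ← Real.rpow_def_of_pos h2ε]
  have h1 : ∑' j, min (S.l j) (2 * ε) = 2 * ε * ∑' j, min (S.l j * (2 * ε)⁻¹) 1 := by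
    rw [← tsum_mul_left]
    refine tsum_congr fun j => ?_
    rw [mul_min_of_nonneg _ _ h2ε.le]
    congr 1 <;> field_simp
  rw [h1, eq_div_iff (Real.rpow_pos_of_pos hε0 _).ne']
  have h3 : (2 * ε) ^ D * (2 ^ (1 - D) * ε ^ (1 - D)) = 2 * ε := by
    rw [← Real.mul_rpow zero_le_two hε0.le, ← Real.rpow_add h2ε, add_sub_cancel, Real.rpow_one]
  linear_combination (∑' j, min (S.l j * (2 * ε)⁻¹) 1) * h3

lemma tendsto_tsum_fract_div_rpow_of_isBigO {D c δ : ℝ} (hδ : 0 < δ)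
    (h : (fun x : ℝ => S.Nnu x - (S.weyl x - c * x ^ D)) =O[atTop] fun x : ℝ => x ^ (D - δ)) :
    Tendsto (fun x : ℝ => (∑' j, Int.fract (S.l j * x)) / x ^ D) atTop (𝓝 c) := by
  have h1 : (fun x : ℝ => (S.Nnu x - (S.weyl x - c * x ^ D)) * x ^ (-D)) =O[atTop]
      fun x : ℝ => x ^ (-δ) := by
    refine (h.mul (isBigO_refl (fun x : ℝ => x ^ (-D)) atTop)).congr' EventuallyEq.rfl ?_
    filter_upwards [eventually_gt_atTop (0 : ℝ)] with x hx
    rw [← Real.rpow_add hx]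
    congr 1
    ring
  have h2 := (h1.trans_tendsto (tendsto_rpow_neg_atTop hδ)).const_sub c
  rw [sub_zero] at h2
  refine h2.congr' ?_
  filter_upwards [eventually_gt_atTop (0 : ℝ)] with x hx
  rw [← (S.weyl_sub_Nnu hx).2, Real.rpow_neg hx.le]
  have := Real.rpow_pos_of_pos hx D
  field_simp
  ring

end Tube

end FractalString

/-- The Riemann hypothesis holds if and only if the inverse spectral problem
for fractal strings has a positive answer in every dimension
`D ∈ (0,1) \ {1/2}`: if the spectral counting function of a string of
dimension `D` satisfies `N_ν(x) = W(x) - c_D x^D + O(x^{D-δ})` for some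
`c_D > 0`, `δ > 0`, then the string is Minkowski measurable of dimension `D`. -/
theorem riemannHypothesis_iff_inverseSpectralProblem :
    (∀ s : ℂ, riemannZeta s = 0 → 0 < s.re → s.re < 1 → s.re = 1 / 2) ↔
      ∀ D : ℝ, D ∈ Set.Ioo (0 : ℝ) 1 → D ≠ 1 / 2 →
        ∀ S : FractalString, S.dimension = D →
          (∃ cD : ℝ, 0 < cD ∧ ∃ δ : ℝ, 0 < δ ∧
            (fun x : ℝ => S.Nnu x - (S.weyl x - cD * x ^ D)) =O[atTop]
              fun x : ℝ => x ^ (D - δ)) →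
          S.MinkowskiMeasurable D := by
  constructor
  · rintro hRH D hD hD2 S - ⟨cD, hc, δ, hδ, hO⟩
    refine S.minkowskiMeasurable_of_tendsto hD hc (fun s hs h0 => hD2 ?_)
      (S.tendsto_tsum_fract_div_rpow_of_isBigO hδ hO)
    rw [← hs]
    exact hRH s h0 (hs ▸ hD.1) (hs ▸ hD.2)
  · intro h s h0 hs hs1
    by_contra hne
    obtain ⟨S, hdim, hO, hnot⟩ :=
      FractalString.exists_not_minkowskiMeasurable_of_riemannZeta_eq_zero h0 hs hs1
    exact hnot (h s.re ⟨hs, hs1⟩ hne S hdim hO)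
end

section
/- Let c > 1 and let a_c = Σ_{n=1}^∞ T_{log n} be the spectral operator on H_c (the series converging in operator norm). Then the spectrum of a_c, as an element of the Banach algebra of bounded linear operators on H_c, is the closure of the range of the Riemann zeta function on the vertical line Re(s) = c: σ(a_c) = cl({ζ(c + iτ) : τ ∈ ℝ}). -/
open MeasureTheory Filter Topology

/-- The weighted measure `e^{-2ct} dt` on the real line, defining the
weighted Hilbert space `H_c = L²(ℝ, e^{-2ct} dt)`. -/
noncomputable def mu (c : ℝ) : Measure ℝ :=
  volume.withDensity fun t => ENNReal.ofReal (Real.exp (-2 * c * t))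

/-- The weighted Hilbert space `H_c = L²(ℝ, e^{-2ct} dt)`. -/
noncomputable abbrev Hc (c : ℝ) : Type := Lp ℂ 2 (mu c)

/-- `T` acts on `H_c` as the translation operator `(T f)(u) = f(u - t)`. -/
def IsTranslation (c t : ℝ) (T : Hc c →L[ℂ] Hc c) : Prop :=
  ∀ f : Hc c, (T f : ℝ → ℂ) =ᵐ[mu c] fun u => (f : ℝ → ℂ) (u - t)

section Multiplication

variable {α : Type*} [TopologicalSpace α] [MeasurableSpace α] [OpensMeasurableSpace α]
  {μ : Measure α}

theorem memLp_boundedContinuous_mul (h : BoundedContinuousFunction α ℂ) {f : α → ℂ}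
    (hf : MemLp f 2 μ) : MemLp (fun x => h x * f x) 2 μ :=
  hf.of_le_mul (c := ‖h‖) (h.continuous.aestronglyMeasurable.mul hf.1)
    (ae_of_all _ fun x => by
      rw [norm_mul]
      gcongr
      exact h.norm_coe_le_norm x)

/-- Multiplication by a bounded continuous function, as a bounded operator on `L²`. -/
noncomputable def mulOp (μ : Measure α) (h : BoundedContinuousFunction α ℂ) :
    Lp ℂ 2 μ →L[ℂ] Lp ℂ 2 μ :=
  LinearMap.mkContinuous
    { toFun := fun f => (memLp_boundedContinuous_mul h (Lp.memLp f)).toLp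
      map_add' := fun f g => by
        rw [← MemLp.toLp_add]
        apply MemLp.toLp_congr
        filter_upwards [Lp.coeFn_add f g] with x hx
        simp only [hx, Pi.add_apply, mul_add]
      map_smul' := fun a f => by
        rw [RingHom.id_apply, ← MemLp.toLp_const_smul]
        apply MemLp.toLp_congr
        filter_upwards [Lp.coeFn_smul a f] with x hx
        simp only [hx, Pi.smul_apply, smul_eq_mul]
        ring }
    ‖h‖
    fun f => by
      refine Lp.norm_le_mul_norm_of_ae_le_mul ?_
      filter_upwards [(memLp_boundedContinuous_mul h (Lp.memLp f)).coeFn_toLp] with x hx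
      simp only [LinearMap.coe_mk, AddHom.coe_mk, hx, norm_mul]
      gcongr
      exact h.norm_coe_le_norm x

theorem coeFn_mulOp (h : BoundedContinuousFunction α ℂ) (f : Lp ℂ 2 μ) :
    mulOp μ h f =ᵐ[μ] fun x => h x * f x :=
  (memLp_boundedContinuous_mul h (Lp.memLp f)).coeFn_toLp

theorem norm_mulOp_le (h : BoundedContinuousFunction α ℂ) : ‖mulOp μ h‖ ≤ ‖h‖ :=
  LinearMap.mkContinuous_norm_le _ (norm_nonneg h) _

/-- Multiplication operators on `L²` as an algebra homomorphism. -/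
noncomputable def mulOpAlgHom (μ : Measure α) :
    BoundedContinuousFunction α ℂ →ₐ[ℂ] (Lp ℂ 2 μ →L[ℂ] Lp ℂ 2 μ) :=
  AlgHom.ofLinearMap
    { toFun := mulOp μ
      map_add' := fun h k => by
        ext1 f
        apply Lp.ext
        filter_upwards [coeFn_mulOp (h + k) f, coeFn_mulOp h f, coeFn_mulOp k f,
          Lp.coeFn_add (mulOp μ h f) (mulOp μ k f)] with x h1 h2 h3 h4
        rw [add_apply, h1, h4, Pi.add_apply, h2, h3,
          BoundedContinuousFunction.add_apply, add_mul]
      map_smul' := fun a h => by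
        ext1 f
        apply Lp.ext
        filter_upwards [coeFn_mulOp (a • h) f, coeFn_mulOp h f,
          Lp.coeFn_smul a (mulOp μ h f)] with x h1 h2 h3
        simp [h1, h2, h3, mul_assoc] }
    (by
      ext1 f
      apply Lp.ext
      filter_upwards [coeFn_mulOp 1 f] with x h1
      simp [h1])
    fun h k => by
      ext1 f
      apply Lp.ext
      filter_upwards [coeFn_mulOp (h * k) f, coeFn_mulOp h (mulOp μ k f),
        coeFn_mulOp k f] with x h1 h2 h3
      simp [h1, h2, h3, mul_assoc]

theorem continuous_mulOpAlgHom : Continuous (mulOpAlgHom μ) :=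
  AddMonoidHomClass.continuous_of_bound _ 1 fun h => by
    rw [one_mul]
    exact norm_mulOp_le h

theorem isUnit_mulOp_iff [IsLocallyFiniteMeasure μ] [μ.IsOpenPosMeasure]
    (h : BoundedContinuousFunction α ℂ) :
    IsUnit (mulOpAlgHom μ h) ↔ ∃ ε > 0, ∀ x, ε ≤ ‖h x‖ := by
  constructor
  · intro hu
    obtain ⟨B, hB⟩ := hu.exists_left_inv
    refine ⟨(‖B‖ + 1)⁻¹, by positivity, ?_⟩
    by_contra! hcon
    obtain ⟨x₀, hx₀⟩ := hcon
    obtain ⟨V, hxV, hVo, hVfin⟩ := μ.exists_isOpen_measure_lt_top x₀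
    have hso : IsOpen ({x | ‖h x‖ < (‖B‖ + 1)⁻¹} ∩ V) :=
      (isOpen_lt h.continuous.norm continuous_const).inter hVo
    set s := {x | ‖h x‖ < (‖B‖ + 1)⁻¹} ∩ V with hs
    have hsfin : μ s ≠ ⊤ := ((measure_mono Set.inter_subset_right).trans_lt hVfin).ne
    have hspos : μ s ≠ 0 := (hso.measure_pos μ ⟨x₀, hx₀, hxV⟩).ne'
    set f : Lp ℂ 2 μ := indicatorConstLp 2 hso.measurableSet hsfin (1 : ℂ) with hf
    have hfpos : 0 < ‖f‖ := by
      rw [hf, norm_indicatorConstLp (by norm_num) (by norm_num), norm_one, one_mul]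
      exact Real.rpow_pos_of_pos (ENNReal.toReal_pos hspos hsfin) _
    have hle : ‖mulOp μ h f‖ ≤ (‖B‖ + 1)⁻¹ * ‖f‖ := by
      refine Lp.norm_le_mul_norm_of_ae_le_mul ?_
      filter_upwards [coeFn_mulOp h f, indicatorConstLp_coeFn (p := 2)
        (hs := hso.measurableSet) (hμs := hsfin) (c := (1 : ℂ))] with x h1 h2
      rw [h1, norm_mul, hf, h2]
      by_cases hx : x ∈ s
      · gcongr
        exact hx.1.le
      · simp [hx]
    have hinv : B (mulOp μ h f) = f := DFunLike.congr_fun hB f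
    have h2 : ‖f‖ ≤ ‖B‖ * ((‖B‖ + 1)⁻¹ * ‖f‖) := by
      calc ‖f‖ = ‖B (mulOp μ h f)‖ := by rw [hinv]
        _ ≤ ‖B‖ * ‖mulOp μ h f‖ := B.le_opNorm _
        _ ≤ _ := by gcongr
    have h3 : ‖B‖ * (‖B‖ + 1)⁻¹ < 1 := by
      rw [← div_eq_mul_inv, div_lt_one (by positivity)]
      linarith
    nlinarith
  · rintro ⟨ε, hε, hh⟩
    have hne : ∀ x, h x ≠ 0 := fun x => norm_pos_iff.1 (hε.trans_le (hh x))
    let k : BoundedContinuousFunction α ℂ :=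
      BoundedContinuousFunction.ofNormedAddCommGroup (fun x => (h x)⁻¹)
        (h.continuous.inv₀ hne) ε⁻¹ fun x => by
          rw [norm_inv]
          exact inv_anti₀ hε (hh x)
    have hk : h * k = 1 := by
      ext x
      exact mul_inv_cancel₀ (hne x)
    exact (IsUnit.of_mul_eq_one k hk).map (mulOpAlgHom μ)

/-- The spectrum of multiplication by a bounded continuous function is the closure of its range. -/
theorem spectrum_mulOp [IsLocallyFiniteMeasure μ] [μ.IsOpenPosMeasure]
    (h : BoundedContinuousFunction α ℂ) :
    spectrum ℂ (mulOpAlgHom μ h) = closure (Set.range h) := by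
  ext z
  rw [spectrum.mem_iff, ← AlgHom.commutes (mulOpAlgHom μ) z, ← map_sub, isUnit_mulOp_iff,
    Metric.mem_closure_range_iff]
  push Not
  simp [dist_eq_norm]

end Multiplication

section Weight

theorem mu_absolutelyContinuous (c : ℝ) : mu c ≪ volume :=
  withDensity_absolutelyContinuous _ _

theorem absolutelyContinuous_mu (c : ℝ) : volume ≪ mu c :=
  withDensity_absolutelyContinuous' (by fun_prop) (ae_of_all _ fun t => by positivity)

theorem eLpNorm_exp_mul (c : ℝ) (f : ℝ → ℂ) :
    eLpNorm (fun t => (Real.exp (-(c * t)) : ℂ) * f t) 2 volume = eLpNorm f 2 (mu c) := by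
  rw [eLpNorm_eq_lintegral_rpow_enorm_toReal (by norm_num) (by norm_num),
    eLpNorm_eq_lintegral_rpow_enorm_toReal (by norm_num) (by norm_num), mu,
    lintegral_withDensity_eq_lintegral_mul_non_measurable _ (by fun_prop)
      (ae_of_all _ fun t => ENNReal.ofReal_lt_top)]
  congr 2
  ext t
  simp only [Pi.mul_apply, enorm_mul, ENNReal.toReal_ofNat, ENNReal.rpow_ofNat, mul_pow]
  congr 1
  rw [← ofReal_norm, Complex.norm_real, Real.norm_of_nonneg (Real.exp_pos _).le,
    ← ENNReal.ofReal_pow (Real.exp_pos _).le, ← Real.exp_nat_mul]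
  congr 2
  push_cast
  ring

theorem memLp_exp_mul (c : ℝ) {f : ℝ → ℂ} (hf : MemLp f 2 (mu c)) :
    MemLp (fun t => (Real.exp (-(c * t)) : ℂ) * f t) 2 volume := by
  refine ⟨?_, ?_⟩
  · exact (Continuous.aestronglyMeasurable (by fun_prop)).mul
      (hf.1.mono_ac (absolutelyContinuous_mu c))
  · rw [eLpNorm_exp_mul]
    exact hf.2

theorem memLp_mu_exp_mul (c : ℝ) {f : ℝ → ℂ} (hf : MemLp f 2 volume) :
    MemLp (fun t => (Real.exp (c * t) : ℂ) * f t) 2 (mu c) := by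
  refine ⟨?_, ?_⟩
  · exact (Continuous.aestronglyMeasurable (by fun_prop)).mul
      (hf.1.mono_ac (mu_absolutelyContinuous c))
  · rw [← eLpNorm_exp_mul]
    convert hf.2 using 3 with t
    rw [← mul_assoc, ← Complex.ofReal_mul, ← Real.exp_add]
    simp

/-- The isometry `f ↦ e^{-ct} f` from `H_c` onto `L²(ℝ)`. -/
noncomputable def weightEquiv (c : ℝ) : Hc c ≃ₗᵢ[ℂ] Lp ℂ 2 (volume : Measure ℝ) where
  toFun f := (memLp_exp_mul c (Lp.memLp f)).toLp
  invFun f := (memLp_mu_exp_mul c (Lp.memLp f)).toLp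
  map_add' f g := by
    rw [← MemLp.toLp_add]
    apply MemLp.toLp_congr
    filter_upwards [(absolutelyContinuous_mu c).ae_le (Lp.coeFn_add f g)] with x hx
    simp only [hx, Pi.add_apply, mul_add]
  map_smul' a f := by
    rw [RingHom.id_apply, ← MemLp.toLp_const_smul]
    apply MemLp.toLp_congr
    filter_upwards [(absolutelyContinuous_mu c).ae_le (Lp.coeFn_smul a f)] with x hx
    simp only [hx, Pi.smul_apply, smul_eq_mul]
    ring
  left_inv f := by
    apply Lp.ext
    refine (MemLp.coeFn_toLp _).trans ?_
    filter_upwards [(mu_absolutelyContinuous c).ae_le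
      (memLp_exp_mul c (Lp.memLp f)).coeFn_toLp] with x hx
    rw [hx, ← mul_assoc, ← Complex.ofReal_mul, ← Real.exp_add]
    simp
  right_inv f := by
    apply Lp.ext
    refine (MemLp.coeFn_toLp _).trans ?_
    filter_upwards [(absolutelyContinuous_mu c).ae_le
      (memLp_mu_exp_mul c (Lp.memLp f)).coeFn_toLp] with x hx
    rw [hx, ← mul_assoc, ← Complex.ofReal_mul, ← Real.exp_add]
    simp
  norm_map' f := by
    simp only [LinearEquiv.coe_mk, LinearMap.coe_mk, AddHom.coe_mk, Lp.norm_toLp]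
    rw [eLpNorm_exp_mul, Lp.norm_def]

theorem coeFn_weightEquiv (c : ℝ) (f : Hc c) :
    weightEquiv c f =ᵐ[volume] fun t => (Real.exp (-(c * t)) : ℂ) * f t :=
  (memLp_exp_mul c (Lp.memLp f)).coeFn_toLp

theorem coeFn_weightEquiv_symm (c : ℝ) (f : Lp ℂ 2 (volume : Measure ℝ)) :
    (weightEquiv c).symm f =ᵐ[mu c] fun t => (Real.exp (c * t) : ℂ) * f t :=
  (memLp_mu_exp_mul c (Lp.memLp f)).coeFn_toLp

end Weight

section Fourier

open scoped FourierTransform SchwartzMap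

/-- Translation by `t` on `L²(ℝ)`. -/
noncomputable def translateLp (t : ℝ) :
    Lp ℂ 2 (volume : Measure ℝ) →ₗᵢ[ℂ] Lp ℂ 2 (volume : Measure ℝ) :=
  Lp.compMeasurePreservingₗᵢ ℂ (fun u => u - t) (measurePreserving_sub_right volume t)

theorem coeFn_translateLp (t : ℝ) (f : Lp ℂ 2 (volume : Measure ℝ)) :
    translateLp t f =ᵐ[volume] fun u => f (u - t) :=
  Lp.coeFn_compMeasurePreserving f (measurePreserving_sub_right volume t)

/-- The symbol `ξ ↦ e^{-t(c + 2πiξ)}` of the translation by `t` on `H_c`. -/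
noncomputable def translationSymbol (c t : ℝ) : BoundedContinuousFunction ℝ ℂ :=
  BoundedContinuousFunction.ofNormedAddCommGroup
    (fun ξ : ℝ => Complex.exp (-(t * (c + (2 * Real.pi * ξ : ℝ) * Complex.I))))
    (by fun_prop) (Real.exp (-(c * t))) fun ξ => by
      rw [Complex.norm_exp]
      apply le_of_eq
      congr 1
      simp [mul_comm]

theorem translationSymbol_apply (c t ξ : ℝ) : translationSymbol c t ξ =
    Complex.exp (-(t * (c + (2 * Real.pi * ξ : ℝ) * Complex.I))) := rfl

theorem norm_translationSymbol_le (c t : ℝ) : ‖translationSymbol c t‖ ≤ Real.exp (-(c * t)) :=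
  BoundedContinuousFunction.norm_ofNormedAddCommGroup_le _ (Real.exp_pos _).le _

theorem fourier_comp_sub (φ : ℝ → ℂ) (t ξ : ℝ) :
    𝓕 (fun u => φ (u - t)) ξ = translationSymbol 0 t ξ * 𝓕 φ ξ := by
  rw [Real.fourier_real_eq_integral_exp_smul, Real.fourier_real_eq_integral_exp_smul,
    ← integral_const_mul, ← integral_add_right_eq_self _ t]
  congr 1
  ext v
  rw [add_sub_cancel_right, translationSymbol_apply, smul_eq_mul, smul_eq_mul,
    ← mul_assoc, ← Complex.exp_add]
  congr 2
  push_cast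
  ring

theorem fourier_translateLp (t : ℝ) (f : Lp ℂ 2 (volume : Measure ℝ)) :
    Lp.fourierTransformₗᵢ ℝ ℂ (translateLp t f) =
      mulOp volume (translationSymbol 0 t) (Lp.fourierTransformₗᵢ ℝ ℂ f) := by
  refine DenseRange.induction_on (SchwartzMap.denseRange_toLpCLM (p := 2)
    ENNReal.ofNat_ne_top) f (isClosed_eq ?_ ?_) fun φ => ?_
  · fun_prop
  · fun_prop
  · have h1 : translateLp t (φ.toLp 2) = (φ.compSubConstCLM ℂ t).toLp 2 := by
      apply Lp.ext
      refine (coeFn_translateLp t _).trans (EventuallyEq.trans ?_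
        (SchwartzMap.coeFn_toLp _ 2 volume).symm)
      exact (measurePreserving_sub_right volume t).quasiMeasurePreserving.ae_eq_comp
        (SchwartzMap.coeFn_toLp φ 2 volume)
    have h2 : ∀ ψ : 𝓢(ℝ, ℂ), Lp.fourierTransformₗᵢ ℝ ℂ (ψ.toLp 2) = (𝓕 ψ).toLp 2 :=
      SchwartzMap.toLp_fourier_eq
    rw [SchwartzMap.toLpCLM_apply, h1, h2, h2]
    apply Lp.ext
    refine (SchwartzMap.coeFn_toLp _ 2 volume).trans
      (EventuallyEq.trans ?_ (coeFn_mulOp _ _).symm)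
    filter_upwards [SchwartzMap.coeFn_toLp (𝓕 φ) 2 volume] with ξ hξ
    rw [hξ, SchwartzMap.fourier_coe, SchwartzMap.fourier_coe]
    exact fourier_comp_sub φ t ξ

end Fourier

/-- The isometry of `H_c` onto `L²(ℝ)` diagonalizing translations. -/
noncomputable def laplaceEquiv (c : ℝ) : Hc c ≃ₗᵢ[ℂ] Lp ℂ 2 (volume : Measure ℝ) :=
  (weightEquiv c).trans (Lp.fourierTransformₗᵢ ℝ ℂ)

/-- The operator on `H_c` whose symbol is the bounded continuous function `h`. -/
noncomputable def symbolOp (c : ℝ) (h : BoundedContinuousFunction ℝ ℂ) : Hc c →L[ℂ] Hc c :=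
  (laplaceEquiv c).symm.toContinuousLinearEquiv.conjContinuousAlgEquiv (mulOpAlgHom volume h)

theorem spectrum_symbolOp (c : ℝ) (h : BoundedContinuousFunction ℝ ℂ) :
    spectrum ℂ (symbolOp c h) = closure (Set.range h) := by
  rw [symbolOp, AlgEquiv.spectrum_eq, spectrum_mulOp]

theorem hasSum_symbolOp (c : ℝ) {ι : Type*} {h : ι → BoundedContinuousFunction ℝ ℂ}
    {g : BoundedContinuousFunction ℝ ℂ} (hg : HasSum h g) :
    HasSum (fun i => symbolOp c (h i)) (symbolOp c g) :=
  (hg.map (mulOpAlgHom volume) continuous_mulOpAlgHom).map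
    (laplaceEquiv c).symm.toContinuousLinearEquiv.conjContinuousAlgEquiv
    (ContinuousAlgEquiv.continuous _)

theorem isTranslation_symbolOp (c t : ℝ) :
    IsTranslation c t (symbolOp c (translationSymbol c t)) := by
  intro f
  have hsymb : translationSymbol c t = (Real.exp (-(c * t)) : ℂ) • translationSymbol 0 t := by
    ext ξ
    simp only [BoundedContinuousFunction.coe_smul, translationSymbol_apply, smul_eq_mul,
      Complex.ofReal_exp, ← Complex.exp_add]
    congr 1
    push_cast
    ring
  have h1 : symbolOp c (translationSymbol c t) f =
      (weightEquiv c).symm ((Real.exp (-(c * t)) : ℂ) • translateLp t (weightEquiv c f)) := by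
    apply (laplaceEquiv c).injective
    have h2 : laplaceEquiv c (symbolOp c (translationSymbol c t) f) =
        mulOpAlgHom volume (translationSymbol c t) (laplaceEquiv c f) :=
      (laplaceEquiv c).apply_symm_apply _
    rw [h2, hsymb, map_smul]
    simp only [laplaceEquiv, LinearIsometryEquiv.trans_apply,
      LinearIsometryEquiv.apply_symm_apply, map_smul, fourier_translateLp]
    rfl
  rw [h1]
  refine (coeFn_weightEquiv_symm c _).trans ?_
  have hw := (measurePreserving_sub_right volume t).quasiMeasurePreserving.ae_eq_comp
    (coeFn_weightEquiv c f)
  filter_upwards [(mu_absolutelyContinuous c).ae_le (Lp.coeFn_smul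
      (Real.exp (-(c * t)) : ℂ) (translateLp t (weightEquiv c f))),
    (mu_absolutelyContinuous c).ae_le (coeFn_translateLp t (weightEquiv c f)),
    (mu_absolutelyContinuous c).ae_le hw] with u h2 h3 h4
  simp only [Function.comp_apply] at h4
  rw [h2, Pi.smul_apply, h3, h4, smul_eq_mul, ← mul_assoc, ← mul_assoc, ← Complex.ofReal_mul,
    ← Complex.ofReal_mul, ← Real.exp_add, ← Real.exp_add]
  ring_nf
  simp

theorem exp_neg_mul_log_nat_add_one (s : ℂ) (n : ℕ) :
    Complex.exp (-((Real.log ((n : ℝ) + 1) : ℝ) * s)) = 1 / ((n : ℂ) + 1) ^ s := by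
  have hn : ((n : ℂ) + 1) ≠ 0 := by exact_mod_cast n.succ_ne_zero
  rw [Complex.cpow_def_of_ne_zero hn, Complex.exp_neg, one_div,
    Complex.ofReal_log (by positivity)]
  push_cast
  rfl

theorem summable_translationSymbol_log {c : ℝ} (hc : 1 < c) :
    Summable fun n : ℕ => translationSymbol c (Real.log ((n : ℝ) + 1)) := by
  have hs : Summable fun n : ℕ => 1 / ((n + 1 : ℕ) : ℝ) ^ c :=
    (summable_nat_add_iff 1).2 (Real.summable_one_div_nat_rpow.2 hc)
  refine Summable.of_norm_bounded hs fun n => (norm_translationSymbol_le _ _).trans (le_of_eq ?_)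
  have hn : (0 : ℝ) < n + 1 := by positivity
  push_cast
  rw [Real.rpow_def_of_pos hn, one_div, ← Real.exp_neg, mul_comm]

theorem tsum_translationSymbol_log {c : ℝ} (hc : 1 < c) (ξ : ℝ) :
    (∑' n : ℕ, translationSymbol c (Real.log ((n : ℝ) + 1))) ξ =
      riemannZeta (c + (2 * Real.pi * ξ : ℝ) * Complex.I) := by
  rw [zeta_eq_tsum_one_div_nat_add_one_cpow (by simpa using hc)]
  have h := (summable_translationSymbol_log hc).hasSum.map
    (BoundedContinuousFunction.evalCLM ℂ ξ) (BoundedContinuousFunction.evalCLM ℂ ξ).continuous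
  refine h.tsum_eq.symm.trans (tsum_congr fun n => ?_)
  exact exp_neg_mul_log_nat_add_one _ n

/-- For `c > 1`, the spectrum of the spectral operator
`a_c = Σ_{n≥1} T_{log n}` (the series converging in operator norm) is the
closure of the range of the Riemann zeta function on the line `Re(s) = c`. -/
theorem spectralOperator_spectrum (c : ℝ) (hc : 1 < c) :
    ∃ T : ℕ → Hc c →L[ℂ] Hc c,
      (∀ n : ℕ, IsTranslation c (Real.log ((n : ℝ) + 1)) (T n)) ∧
      ∃ A : Hc c →L[ℂ] Hc c, HasSum T A ∧
        spectrum ℂ A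
          = closure (Set.range fun τ : ℝ => riemannZeta (c + τ * Complex.I)) := by
  refine ⟨fun n => symbolOp c (translationSymbol c (Real.log ((n : ℝ) + 1))),
    fun n => isTranslation_symbolOp c _,
    symbolOp c (∑' n : ℕ, translationSymbol c (Real.log ((n : ℝ) + 1))),
    hasSum_symbolOp c (summable_translationSymbol_log hc).hasSum, ?_⟩
  rw [spectrum_symbolOp]
  have hsurj : Function.Surjective fun ξ : ℝ => 2 * Real.pi * ξ :=
    mul_left_surjective₀ Real.two_pi_pos.ne'
  rw [← hsurj.range_comp fun τ : ℝ => riemannZeta (c + τ * Complex.I)]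
  congr 2
  ext ξ
  exact tsum_translationSymbol_log hc ξ
end

section
/- Let c > 1. For every prime p, the operator Id − T_{log p} is invertible in the algebra of bounded linear operators on H_c (indeed ‖T_{log p}‖ = p^{−c} < 1), and the operator-valued Euler product converges to the spectral operator in operator norm: the finite products Π_{p prime, p ≤ N} (Id − T_{log p})^{−1} converge, as N → ∞, in operator norm to a_c = Σ_{n=1}^∞ T_{log n}. -/
open MeasureTheory Filter Topology

section Translation

variable (c t : ℝ)

lemma measurePreserving_sub_right_mu :
    MeasurePreserving (fun u : ℝ => u - t) (mu c)
      (ENNReal.ofReal (Real.exp (-2 * c * t)) • mu c) := by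
  refine ⟨measurable_sub_const t, ?_⟩
  ext s hs
  have hw : Measurable fun u : ℝ => ENNReal.ofReal (Real.exp (-2 * c * u)) := by fun_prop
  rw [Measure.map_apply (measurable_sub_const t) hs, mu,
    withDensity_apply _ (measurable_sub_const t hs), Measure.smul_apply, withDensity_apply _ hs,
    smul_eq_mul, ← lintegral_const_mul _ hw]
  rw [← (measurePreserving_sub_right volume t).setLIntegral_comp_preimage hs (by fun_prop)]
  refine lintegral_congr fun u => ?_
  rw [← ENNReal.ofReal_mul (Real.exp_pos _).le, ← Real.exp_add]
  congr 2
  ring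

lemma quasiMeasurePreserving_sub_right_mu :
    Measure.QuasiMeasurePreserving (fun u : ℝ => u - t) (mu c) (mu c) :=
  (measurePreserving_sub_right_mu c t).quasiMeasurePreserving.mono_right
    Measure.smul_absolutelyContinuous

lemma eLpNorm_comp_sub_right_mu {f : ℝ → ℂ} (hf : AEStronglyMeasurable f (mu c)) :
    eLpNorm (fun u => f (u - t)) 2 (mu c) =
      ENNReal.ofReal (Real.exp (-c * t)) * eLpNorm f 2 (mu c) := by
  have h := eLpNorm_comp_measurePreserving (p := 2) (hf.smul_measure _)
    (measurePreserving_sub_right_mu c t)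
  rw [Function.comp_def] at h
  rw [h, eLpNorm_smul_measure_of_ne_top (by simp), smul_eq_mul,
    ENNReal.ofReal_rpow_of_pos (Real.exp_pos _), ← Real.exp_mul]
  congr 3
  simp
  ring

lemma memLp_comp_sub_right_mu (f : Hc c) :
    MemLp (fun u => (f : ℝ → ℂ) (u - t)) 2 (mu c) := by
  refine ⟨(Lp.aestronglyMeasurable f).comp_quasiMeasurePreserving
    (quasiMeasurePreserving_sub_right_mu c t), ?_⟩
  rw [eLpNorm_comp_sub_right_mu c t (Lp.aestronglyMeasurable f)]
  exact ENNReal.mul_lt_top ENNReal.ofReal_lt_top (Lp.eLpNorm_lt_top f)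

/-- The function underlying `translation`. -/
noncomputable def translationFun (f : Hc c) : Hc c :=
  (memLp_comp_sub_right_mu c t f).toLp

lemma coeFn_translationFun (f : Hc c) :
    (translationFun c t f : ℝ → ℂ) =ᵐ[mu c] fun u => (f : ℝ → ℂ) (u - t) :=
  (memLp_comp_sub_right_mu c t f).coeFn_toLp

lemma norm_translationFun (f : Hc c) : ‖translationFun c t f‖ = Real.exp (-c * t) * ‖f‖ := by
  rw [translationFun, Lp.norm_toLp, eLpNorm_comp_sub_right_mu c t (Lp.aestronglyMeasurable f),
    ENNReal.toReal_mul, ENNReal.toReal_ofReal (Real.exp_pos _).le, Lp.norm_def]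

lemma translationFun_add (f g : Hc c) :
    translationFun c t (f + g) = translationFun c t f + translationFun c t g := by
  refine Lp.ext ?_
  filter_upwards [coeFn_translationFun c t (f + g), coeFn_translationFun c t f,
    coeFn_translationFun c t g, Lp.coeFn_add (translationFun c t f) (translationFun c t g),
    (quasiMeasurePreserving_sub_right_mu c t).ae_eq_comp (Lp.coeFn_add f g)] with u h₁ h₂ h₃ h₄ h₅
  rw [h₁, h₄, Pi.add_apply, h₂, h₃]
  exact h₅

lemma translationFun_smul (a : ℂ) (f : Hc c) :
    translationFun c t (a • f) = a • translationFun c t f := by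
  refine Lp.ext ?_
  filter_upwards [coeFn_translationFun c t (a • f), coeFn_translationFun c t f,
    Lp.coeFn_smul a (translationFun c t f),
    (quasiMeasurePreserving_sub_right_mu c t).ae_eq_comp (Lp.coeFn_smul a f)] with u h₁ h₂ h₃ h₄
  rw [h₁, h₃, Pi.smul_apply, h₂]
  exact h₄

/-- The translation operator `(T_t f)(u) = f(u - t)` on `H_c`. -/
noncomputable def translation : Hc c →L[ℂ] Hc c :=
  LinearMap.mkContinuous
    { toFun := translationFun c t
      map_add' := translationFun_add c t
      map_smul' := translationFun_smul c t }
    (Real.exp (-c * t)) fun f => (norm_translationFun c t f).le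

lemma isTranslation_translation : IsTranslation c t (translation c t) :=
  coeFn_translationFun c t

lemma norm_translation_apply (f : Hc c) : ‖translation c t f‖ = Real.exp (-c * t) * ‖f‖ :=
  norm_translationFun c t f

lemma translation_zero : translation c 0 = 1 := by
  ext1 f
  refine Lp.ext ((isTranslation_translation c 0 f).trans ?_)
  simp

lemma translation_add (s t : ℝ) :
    translation c (s + t) = translation c s * translation c t := by
  ext1 f
  refine Lp.ext ((isTranslation_translation c (s + t) f).trans ?_)
  refine .trans ?_ (isTranslation_translation c s (translation c t f)).symm
  refine .trans ?_ ((quasiMeasurePreserving_sub_right_mu c s).ae_eq_comp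
    (isTranslation_translation c t f)).symm
  refine .of_forall fun u => ?_
  simp [sub_sub]

instance nontrivial_Hc : Nontrivial (Hc c) := by
  have hw : Continuous fun u : ℝ => Real.exp (-2 * c * u) := by fun_prop
  have htop : mu c (Set.Icc 0 1) ≠ ⊤ := by
    rw [mu, withDensity_apply _ measurableSet_Icc]
    exact hw.integrableOn_Icc.lintegral_lt_top.ne
  have hpos : mu c (Set.Icc 0 1) ≠ 0 := fun h => by
    have hac : volume ≪ mu c := withDensity_absolutelyContinuous' (by fun_prop)
      (.of_forall fun u => by simp [Real.exp_pos])
    simpa using hac h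
  refine ⟨⟨indicatorConstLp 2 measurableSet_Icc htop (1 : ℂ), 0, fun h => ?_⟩⟩
  have hn := norm_indicatorConstLp (E := ℂ) (p := 2) (hs := measurableSet_Icc)
    (hμs := htop) (c := 1) (by simp) (by simp)
  rw [h, norm_zero, norm_one, one_mul] at hn
  exact (Real.rpow_pos_of_pos (ENNReal.toReal_pos hpos htop) _).ne hn

lemma norm_translation : ‖translation c t‖ = Real.exp (-c * t) := by
  refine ContinuousLinearMap.opNorm_eq_of_bounds (Real.exp_pos _).le
    (fun f => (norm_translation_apply c t f).le) fun N _ h => ?_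
  obtain ⟨f, hf⟩ := exists_ne (0 : Hc c)
  have := h f
  rw [norm_translation_apply] at this
  exact le_of_mul_le_mul_right this (norm_pos_iff.mpr hf)

lemma norm_translation_log {x : ℝ} (hx : 0 < x) : ‖translation c (Real.log x)‖ = x ^ (-c) := by
  rw [norm_translation, Real.rpow_def_of_pos hx, mul_comm]

end Translation

section EulerProduct

variable {A : Type*} [NormedRing A] [CompleteSpace A]

/-- The Euler product of a completely multiplicative function with values in a complete normed
ring which is not assumed to be commutative, with the partial products given by recursion. -/
lemma tendsto_eulerProduct_of_completely_multiplicative {f : ℕ → A} (hf₀ : f 0 = 0)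
    (hf₁ : f 1 = 1) (hmul : ∀ m n, f (m * n) = f m * f n) (hsum : Summable (‖f ·‖))
    (hlt : ∀ p : ℕ, p.Prime → ‖f p‖ < 1) {P : ℕ → A} (hP₀ : P 0 = 1)
    (hP : ∀ N : ℕ, P (N + 1) =
      if (N + 1).Prime then P N * Ring.inverse (1 - f (N + 1)) else P N) :
    Tendsto P atTop (𝓝 (∑' n, f n)) := by
  have hcomm : ∀ x ∈ Set.range f, ∀ y ∈ Set.range f, x * y = y * x := by
    rintro _ ⟨m, rfl⟩ _ ⟨n, rfl⟩
    rw [← hmul, ← hmul, mul_comm]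
  let C : Subring A := Subring.closure (Set.range f)
  let S : Subring A := C.topologicalClosure
  let _ : CommRing S := Subring.commRingTopologicalClosure C
    (Subring.isMulCommutative_closure hcomm).is_comm.comm
  let _ : NormedCommRing S :=
    { (inferInstance : NormedRing S) with mul_comm := mul_comm }
  have : CompleteSpace S := C.isClosed_topologicalClosure.completeSpace_coe
  let g : ℕ → S := fun n =>
    ⟨f n, C.le_topologicalClosure (Subring.subset_closure (Set.mem_range_self n))⟩
  have hgsum : Summable (‖g ·‖) := hsum
  have hcoe {h : ℕ → S} (hh : Summable h) : ((∑' n, h n : S) : A) = ∑' n, (h n : A) :=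
    hh.map_tsum S.subtype continuous_subtype_val
  have hpow (p e : ℕ) : f (p ^ e) = f p ^ e := by
    induction e with
    | zero => simpa using hf₁
    | succ e ih => rw [pow_succ, hmul, ih, pow_succ]
  have hfactor (p : ℕ) (hp : p.Prime) :
      ((∑' e, g (p ^ e) : S) : A) = Ring.inverse (1 - f p) := by
    have h : Summable fun e => g (p ^ e) :=
      hgsum.of_norm.comp_injective (Nat.pow_right_injective hp.two_le)
    rw [hcoe h, NormedRing.inverse_one_sub _ (hlt p hp)]
    simp only [g, hpow]
    rfl
  have hprod (N : ℕ) : P N = ((∏ p ∈ (N + 1).primesBelow, ∑' e, g (p ^ e) : S) : A) := by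
    induction N with
    | zero =>
      rw [hP₀, zero_add, Nat.primesBelow_succ 0, if_neg Nat.not_prime_zero, Nat.primesBelow_zero,
        Finset.prod_empty]
      rfl
    | succ N ih =>
      rw [hP, Nat.primesBelow_succ (N + 1)]
      split_ifs with hN
      · rw [Finset.prod_insert (Nat.notMem_primesBelow _), mul_comm, ih, ← hfactor _ hN]
        rfl
      · exact ih
  have hlim := EulerProduct.eulerProduct (f := g) (Subtype.ext hf₁)
    (fun {m n} _ => Subtype.ext (hmul m n)) hgsum (Subtype.ext hf₀)
  have := (continuous_subtype_val.tendsto _).comp (hlim.comp (tendsto_add_atTop_nat 1))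
  rw [hcoe hgsum.of_norm] at this
  exact this.congr fun N => (hprod N).symm

end EulerProduct

/-- For `c > 1`: for every prime `p`, `‖T_{log p}‖ = p^{-c} < 1` and
`Id - T_{log p}` is invertible in the algebra of bounded operators on `H_c`;
moreover the operator-valued Euler product converges to the spectral operator:
the partial products `Π_{p prime, p ≤ N} (Id - T_{log p})⁻¹` (defined
recursively by `P`) converge in operator norm to `a_c = Σ_{n≥1} T_{log n}`. -/
theorem spectralOperator_eulerProduct (c : ℝ) (hc : 1 < c) :
    ∃ T : ℝ → Hc c →L[ℂ] Hc c,
      (∀ t : ℝ, IsTranslation c t (T t)) ∧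
      (∀ p : ℕ, p.Prime →
        ‖T (Real.log p)‖ = (p : ℝ) ^ (-c) ∧ ‖T (Real.log p)‖ < 1 ∧
          IsUnit (1 - T (Real.log p))) ∧
      ∃ A : Hc c →L[ℂ] Hc c,
        HasSum (fun n : ℕ => T (Real.log ((n : ℝ) + 1))) A ∧
        ∃ P : ℕ → Hc c →L[ℂ] Hc c,
          P 0 = 1 ∧
          (∀ N : ℕ, P (N + 1) =
            if (N + 1).Prime then P N * Ring.inverse (1 - T (Real.log ((N : ℝ) + 1)))
            else P N) ∧
          Tendsto P atTop (𝓝 A) := by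
  have hprime (p : ℕ) (hp : p.Prime) : ‖translation c (Real.log p)‖ < 1 := by
    rw [norm_translation_log c (by exact_mod_cast hp.pos)]
    exact Real.rpow_lt_one_of_one_lt_of_neg (by exact_mod_cast hp.one_lt) (by linarith)
  let f : ℕ → Hc c →L[ℂ] Hc c := fun n => if n = 0 then 0 else translation c (Real.log n)
  have hf {n : ℕ} (hn : n ≠ 0) : f n = translation c (Real.log n) := if_neg hn
  have hf₀ : f 0 = 0 := if_pos rfl
  have hf₁ : f 1 = 1 := by simp [hf, translation_zero]
  have hmul (m n : ℕ) : f (m * n) = f m * f n := by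
    rcases eq_or_ne m 0 with rfl | hm
    · simp [hf₀]
    rcases eq_or_ne n 0 with rfl | hn
    · simp [hf₀]
    rw [hf hm, hf hn, hf (mul_ne_zero hm hn), Nat.cast_mul,
      Real.log_mul (by exact_mod_cast hm) (by exact_mod_cast hn), translation_add]
  have hsum : Summable (‖f ·‖) := by
    refine (Real.summable_nat_rpow.mpr (neg_lt_neg hc)).congr fun n => ?_
    rcases eq_or_ne n 0 with rfl | hn
    · simp [hf₀, Real.zero_rpow (neg_ne_zero.mpr (by linarith : c ≠ 0))]
    · rw [hf hn, norm_translation_log c (by positivity)]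
  let P : ℕ → Hc c →L[ℂ] Hc c := fun N => Nat.rec 1 (fun N Q =>
    if (N + 1).Prime then Q * Ring.inverse (1 - translation c (Real.log ((N : ℝ) + 1)))
    else Q) N
  refine ⟨translation c, isTranslation_translation c, fun p hp => ⟨?_, hprime p hp, ?_⟩,
    ∑' n, f n, ?_, P, rfl, fun N => rfl, ?_⟩
  · exact norm_translation_log c (by exact_mod_cast hp.pos)
  · exact isUnit_one_sub_of_norm_lt_one (hprime p hp)
  · have h := (hasSum_nat_add_iff' 1).mpr hsum.of_norm.hasSum
    simpa [hf₀, hf] using h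
  · refine tendsto_eulerProduct_of_completely_multiplicative hf₀ hf₁ hmul hsum
      (fun p hp => by simpa only [hf hp.ne_zero] using hprime p hp) rfl fun N => ?_
    rw [hf N.succ_ne_zero, Nat.cast_succ]
end

section
/- Let (l_j)_{j≥1} be a sequence of positive real numbers with Σ_j l_j < ∞, and let s ∈ ℂ with Re(s) > 1. Then the doubly indexed family ((k · l_j^{−1})^{−s})_{j≥1, k≥1} is (absolutely) summable and its sum factorizes through the Riemann zeta function: Σ_{j≥1} Σ_{k≥1} (k l_j^{−1})^{−s} = (Σ_{j≥1} l_j^{s}) · ζ(s). (That is, the spectral zeta function of the fractal string equals the product of its geometric zeta function with ζ.) -/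
open MeasureTheory Filter Topology

/-- A real sequence that is summable and positive stays summable after raising it to a real
power at least one. -/
lemma Summable.rpow_of_one_le {l : ℕ → ℝ} (hpos : ∀ j, 0 < l j) (hsum : Summable l) {p : ℝ}
    (hp : 1 ≤ p) : Summable fun j => l j ^ p := by
  refine hsum.of_norm_bounded_eventually_nat ?_
  filter_upwards [hsum.tendsto_atTop_zero.eventually_le_const zero_lt_one] with j hj
  rw [Real.norm_of_nonneg (Real.rpow_nonneg (hpos j).le p)]
  exact Real.rpow_le_self_of_le_one (hpos j).le hj hp

lemma Complex.ofReal_mul_inv_cpow_neg {a b : ℝ} (ha : 0 ≤ a) (hb : 0 ≤ b) (s : ℂ) :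
    ((a * b⁻¹ : ℝ) : ℂ) ^ (-s) = (b : ℂ) ^ s * (1 / (a : ℂ) ^ s) := by
  have harg : (b : ℂ).arg ≠ Real.pi := by
    rw [Complex.arg_ofReal_of_nonneg hb]
    exact Real.pi_ne_zero.symm
  rw [Complex.ofReal_mul, Complex.mul_cpow_ofReal_nonneg ha (inv_nonneg.2 hb), Complex.ofReal_inv,
    Complex.inv_cpow _ _ harg, Complex.cpow_neg, Complex.cpow_neg, inv_inv, one_div, mul_comm]

/-- Factorization of the spectral zeta function of a fractal string: for lengths
`(l_j)` with `Σ l_j < ∞` and `Re(s) > 1`, the family of normalized frequencies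
`(k · l_j⁻¹)^{-s}` (`j ≥ 1`, `k ≥ 1`) is absolutely summable and
`Σ_{j,k} (k l_j⁻¹)^{-s} = (Σ_j l_j^s) · ζ(s)`. -/
theorem spectral_zeta_factorization (l : ℕ → ℝ) (hpos : ∀ j, 0 < l j)
    (hsum : Summable l) (s : ℂ) (hs : 1 < s.re) :
    Summable (fun jk : ℕ × ℕ =>
      ‖(((((jk.2 : ℝ) + 1) * (l jk.1)⁻¹ : ℝ) : ℂ)) ^ (-s)‖) ∧
    Summable (fun jk : ℕ × ℕ =>
      (((((jk.2 : ℝ) + 1) * (l jk.1)⁻¹ : ℝ) : ℂ)) ^ (-s)) ∧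
    ∑' jk : ℕ × ℕ, (((((jk.2 : ℝ) + 1) * (l jk.1)⁻¹ : ℝ) : ℂ)) ^ (-s)
      = (∑' j : ℕ, ((l j : ℝ) : ℂ) ^ s) * riemannZeta s := by
  have hl : Summable fun j => ‖((l j : ℝ) : ℂ) ^ s‖ := by
    simpa only [Complex.norm_cpow_eq_rpow_re_of_pos (hpos _)] using
      hsum.rpow_of_one_le hpos hs.le
  have hz : Summable fun k : ℕ => ‖1 / ((k : ℂ) + 1) ^ s‖ := by
    simpa only [Nat.cast_add, Nat.cast_one] using
      ((summable_nat_add_iff 1).2 (Complex.summable_one_div_nat_cpow.2 hs)).norm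
  have hterm (jk : ℕ × ℕ) : (((((jk.2 : ℝ) + 1) * (l jk.1)⁻¹ : ℝ) : ℂ)) ^ (-s) =
      ((l jk.1 : ℝ) : ℂ) ^ s * (1 / ((jk.2 : ℂ) + 1) ^ s) := by
    rw [Complex.ofReal_mul_inv_cpow_neg (by positivity) (hpos _).le]
    push_cast
    rfl
  have hprod := summable_mul_of_summable_norm hl hz
  simp only [hterm]
  exact ⟨hprod.norm, hprod, by
    rw [zeta_eq_tsum_one_div_nat_add_one_cpow hs, tsum_mul_tsum_of_summable_norm hl hz]⟩
end

section
/- Let (l_j)_{j≥1} be a nonincreasing sequence of positive real numbers with Σ_j l_j < ∞ (so l_j → 0), and let N_L(x) := #{j ≥ 1 : l_j ≥ 1/x} denote its geometric counting function. Then the abscissa of convergence D := inf{σ ∈ ℝ : Σ_{j≥1} l_j^σ < ∞} equals the growth exponent of N_L: D = inf{γ ≥ 0 : there exists C > 0 such that N_L(x) ≤ C x^γ for all x ≥ 1}. -/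
open Filter Topology

lemma finite_setOf_le_of_tendsto_zero {l : ℕ → ℝ} (hl : Tendsto l atTop (𝓝 0)) {a : ℝ}
    (ha : 0 < a) : {j : ℕ | a ≤ l j}.Finite := by
  have h := hl.eventually (gt_mem_nhds ha)
  rw [← Nat.cofinite_eq_atTop, eventually_cofinite] at h
  simpa only [not_lt] using h

lemma pos_of_summable_rpow {l : ℕ → ℝ} (hpos : ∀ j, 0 < l j) (hl : Tendsto l atTop (𝓝 0))
    {σ : ℝ} (hσ : Summable fun j => l j ^ σ) : 0 < σ := by
  by_contra! hle
  have h1 := hσ.tendsto_atTop_zero.eventually (gt_mem_nhds one_pos)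
  have h2 := hl.eventually (gt_mem_nhds one_pos)
  obtain ⟨j, hj1, hj2⟩ := (h1.and h2).exists
  exact hj1.not_ge (Real.one_le_rpow_of_pos_of_le_one_of_nonpos (hpos j) hj2.le hle)

lemma ncard_le_tsum_mul_rpow {l : ℕ → ℝ} (hpos : ∀ j, 0 < l j) (hl : Tendsto l atTop (𝓝 0))
    {σ : ℝ} (hσ0 : 0 ≤ σ) (hσ : Summable fun j => l j ^ σ) {x : ℝ} (hx : 0 < x) :
    ({j : ℕ | 1 / x ≤ l j}.ncard : ℝ) ≤ (∑' j, l j ^ σ) * x ^ σ := by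
  have hfin := finite_setOf_le_of_tendsto_zero hl (one_div_pos.2 hx)
  rw [Set.ncard_eq_toFinset_card _ hfin, ← div_le_iff₀ (Real.rpow_pos_of_pos hx σ)]
  calc (hfin.toFinset.card : ℝ) / x ^ σ
      = ∑ _j ∈ hfin.toFinset, (1 / x) ^ σ := by
        rw [Finset.sum_const, nsmul_eq_mul, Real.div_rpow zero_le_one hx.le, Real.one_rpow,
          mul_one_div]
    _ ≤ ∑ j ∈ hfin.toFinset, l j ^ σ := by
        refine Finset.sum_le_sum fun j hj => ?_
        exact Real.rpow_le_rpow (one_div_pos.2 hx).le (by simpa using hj) hσ0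
    _ ≤ ∑' j, l j ^ σ := hσ.sum_le_tsum _ fun j _ => (Real.rpow_pos_of_pos (hpos j) σ).le

lemma succ_mul_rpow_le_of_ncard_le {l : ℕ → ℝ} (hpos : ∀ j, 0 < l j) (hanti : Antitone l)
    (hl : Tendsto l atTop (𝓝 0)) {γ C : ℝ}
    (hC : ∀ x : ℝ, 1 ≤ x → ({j : ℕ | 1 / x ≤ l j}.ncard : ℝ) ≤ C * x ^ γ)
    {j : ℕ} (hj : l j ≤ 1) : ((j : ℝ) + 1) * l j ^ γ ≤ C := by
  have h := hC (l j)⁻¹ ((one_le_inv₀ (hpos j)).2 hj)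
  rw [one_div, inv_inv, Real.inv_rpow (hpos j).le, ← div_eq_mul_inv,
    le_div_iff₀ (Real.rpow_pos_of_pos (hpos j) γ)] at h
  refine le_trans (mul_le_mul_of_nonneg_right ?_ (Real.rpow_pos_of_pos (hpos j) γ).le) h
  have hsub : (↑(Finset.range (j + 1)) : Set ℕ) ⊆ {k : ℕ | l j ≤ l k} := fun k hk =>
    hanti (Nat.lt_succ_iff.1 (Finset.mem_range.1 hk))
  have hcard := Set.ncard_le_ncard hsub (finite_setOf_le_of_tendsto_zero hl (hpos j))
  rw [Set.ncard_coe_finset, Finset.card_range] at hcard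
  exact_mod_cast hcard

lemma summable_rpow_of_ncard_le {l : ℕ → ℝ} (hpos : ∀ j, 0 < l j) (hanti : Antitone l)
    (hl : Tendsto l atTop (𝓝 0)) {γ C : ℝ} (hγ : 0 ≤ γ)
    (hC : ∀ x : ℝ, 1 ≤ x → ({j : ℕ | 1 / x ≤ l j}.ncard : ℝ) ≤ C * x ^ γ)
    {σ : ℝ} (hσ : γ < σ) : Summable fun j => l j ^ σ := by
  have hev : ∀ᶠ j : ℕ in atTop, ((j : ℝ) + 1) * l j ^ γ ≤ C :=
    (hl.eventually (gt_mem_nhds one_pos)).mono fun j hj =>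
      succ_mul_rpow_le_of_ncard_le hpos hanti hl hC hj.le
  rcases hγ.eq_or_lt with rfl | hγ
  · obtain ⟨j, hj, hj'⟩ :=
      (hev.and (tendsto_natCast_atTop_atTop.eventually_ge_atTop C)).exists
    rw [Real.rpow_zero] at hj
    linarith
  · have hs : Summable fun j : ℕ => C ^ (σ / γ) * (1 / ((j + 1 : ℕ) : ℝ) ^ (σ / γ)) :=
      ((summable_nat_add_iff 1).2
        (Real.summable_one_div_nat_rpow.2 ((one_lt_div hγ).2 hσ))).mul_left _
    refine hs.of_norm_bounded_eventually_nat (hev.mono fun j hj => ?_)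
    have hj0 : (0 : ℝ) < (j : ℝ) + 1 := by positivity
    have hlγ := Real.rpow_pos_of_pos (hpos j) γ
    have hC0 : 0 ≤ C := (mul_pos hj0 hlγ).le.trans hj
    rw [Real.norm_of_nonneg (Real.rpow_pos_of_pos (hpos j) σ).le, mul_one_div]
    push_cast
    rw [← Real.div_rpow hC0 hj0.le]
    calc l j ^ σ = (l j ^ γ) ^ (σ / γ) := by
          rw [← Real.rpow_mul (hpos j).le, mul_div_cancel₀ _ hγ.ne']
      _ ≤ (C / (j + 1)) ^ (σ / γ) := by
          refine Real.rpow_le_rpow hlγ.le ?_ (div_pos (hγ.trans hσ) hγ).le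
          rwa [le_div_iff₀' hj0]

/-- For a nonincreasing summable sequence of positive lengths `(l_j)`, the
abscissa of convergence `D = inf{σ : Σ l_j^σ < ∞}` equals the growth exponent
of the geometric counting function `N_L(x) = #{j : l_j ≥ 1/x}`:
`D = inf{γ ≥ 0 : ∃ C > 0, ∀ x ≥ 1, N_L(x) ≤ C x^γ}`. -/
theorem abscissa_eq_counting_exponent (l : ℕ → ℝ) (hpos : ∀ j, 0 < l j)
    (hanti : Antitone l) (hsum : Summable l) :
    sInf {σ : ℝ | Summable fun j => l j ^ σ} =
      sInf {γ : ℝ | 0 ≤ γ ∧ ∃ C : ℝ, 0 < C ∧ ∀ x : ℝ, 1 ≤ x →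
        (({j : ℕ | 1 / x ≤ l j}.ncard : ℝ)) ≤ C * x ^ γ} := by
  have hl := hsum.tendsto_atTop_zero
  have hsub : {σ : ℝ | Summable fun j => l j ^ σ} ⊆
      {γ : ℝ | 0 ≤ γ ∧ ∃ C : ℝ, 0 < C ∧ ∀ x : ℝ, 1 ≤ x →
        (({j : ℕ | 1 / x ≤ l j}.ncard : ℝ)) ≤ C * x ^ γ} := fun σ hσ => by
    have hσ0 := pos_of_summable_rpow hpos hl hσ
    exact ⟨hσ0.le, ∑' j, l j ^ σ,
      hσ.tsum_pos (fun j => (Real.rpow_pos_of_pos (hpos j) σ).le) 0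
        (Real.rpow_pos_of_pos (hpos 0) σ),
      fun x hx => ncard_le_tsum_mul_rpow hpos hl hσ0.le hσ (one_pos.trans_le hx)⟩
  have hne : {σ : ℝ | Summable fun j => l j ^ σ}.Nonempty := ⟨1, by simpa using hsum⟩
  refine le_antisymm (le_csInf (hne.mono hsub) ?_) (csInf_le_csInf ⟨0, fun γ h => h.1⟩ hne hsub)
  rintro γ ⟨hγ, C, -, hC⟩
  refine le_of_forall_gt_imp_ge_of_dense fun σ hσ => csInf_le ⟨0, fun τ hτ => ?_⟩ ?_
  · exact (pos_of_summable_rpow hpos hl hτ).le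
  · exact summable_rpow_of_ncard_le hpos hanti hl hγ hC hσ
end
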